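/- arXiv:1612.01932 — 7 statements merged into one kernel-verified Lean document; each statement's English description precedes it below -/
import Mathlib

section
/- Let w be a weight on ℝⁿ and let δ > 1. Assume the Fujii–Wilson condition with constant δ: for every bounded axis-parallel cube Q in ℝⁿ, ∫_Q M(w·1_Q) dx ≤ δ·w(Q). Then for every bounded axis-parallel cube Q and every exponent r with 1 ≤ r < 1 + 1/(2ⁿ(δ−1)), one has (1/|Q|)∫_Q wʳ dx ≤ δ · (r′−1)/(r′−1−2ⁿ(δ−1)) · ((1/|Q|)∫_Q w dx)ʳ. -/
open MeasureTheory Set ENNReal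

noncomputable section

/-- A bounded axis-parallel open cube in `ℝⁿ`. -/
def IsCube {n : ℕ} (Q : Set (Fin n → ℝ)) : Prop :=
  ∃ (a : Fin n → ℝ) (s : ℝ), 0 < s ∧ Q = Set.univ.pi fun i => Set.Ioo (a i) (a i + s)

/-- The non-centered Hardy–Littlewood maximal operator over axis-parallel cubes in `ℝⁿ`. -/
def maximal {n : ℕ} (f : (Fin n → ℝ) → ℝ) (x : Fin n → ℝ) : ℝ≥0∞ :=
  ⨆ (Q : Set (Fin n → ℝ)) (_ : IsCube Q) (_ : x ∈ Q),
    (∫⁻ y in Q, ENNReal.ofReal |f y|) / volume Q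

theorem lintegral_iSup_sub_le_of_cell {X ι : Type*} [MeasurableSpace X] {μ : Measure X}
    [MeasurableSpace ι] [Countable ι] [MeasurableSingletonClass ι]
    {c : ℕ → X → ι} (hc : ∀ k, Measurable (c k))
    (hnest : ∀ k x y, c (k + 1) x = c (k + 1) y → c k x = c k y)
    {C δ t : ℝ≥0∞} (ht : t ≠ ∞) {F : ℕ → ι → ℝ≥0∞} (k : ℕ) (x : X)
    (hfin : μ (c k ⁻¹' {c k x}) ≠ ∞)
    (hdoub : ∀ y, c k y = c k x →
      μ (c k ⁻¹' {c k x}) ≤ C * μ (c (k + 1) ⁻¹' {c (k + 1) y}))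
    (hFW : ∫⁻ z in c k ⁻¹' {c k x}, ⨆ j, F (k + j) (c (k + j) z) ∂μ ≤
      δ * (F k (c k x) * μ (c k ⁻¹' {c k x})))
    (hle : ∀ j ≤ k, F j (c j x) ≤ t)
    (hex : ∃ y, c k y = c k x ∧ t < F (k + 1) (c (k + 1) y)) :
    ∫⁻ z in c k ⁻¹' {c k x}, ((⨆ j, F j (c j z)) - t) ∂μ ≤
      C * (δ - 1) * t * μ ({z | t < ⨆ j, F j (c j z)} ∩ c k ⁻¹' {c k x}) := by
  have hnest' : ∀ y, c k y = c k x → ∀ j ≤ k, c j y = c j x := by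
    intro y hy j hj
    exact Nat.decreasingInduction (motive := fun j _ => c j y = c j x)
      (fun i _ h => hnest i y x h) hy hj
  have hms : MeasurableSet (c k ⁻¹' {c k x}) := hc k (measurableSet_singleton _)
  have hE : F k (c k x) ≠ ∞ := ne_top_of_le_ne_top ht (hle k le_rfl)
  have h1 : ∫⁻ z in c k ⁻¹' {c k x}, ((⨆ j, F j (c j z)) - t) ∂μ ≤
      ∫⁻ z in c k ⁻¹' {c k x}, ((⨆ j, F (k + j) (c (k + j) z)) - F k (c k x)) ∂μ := by
    refine setLIntegral_mono' hms fun z hz => ?_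
    refine tsub_le_iff_right.2 (iSup_le fun j => ?_)
    have hkx : F k (c k x) ≤ ⨆ j, F (k + j) (c (k + j) z) := by
      refine le_trans ?_ (le_iSup _ 0)
      have : c k z = c k x := hz
      simp [this]
    rcases le_total j k with hj | hj
    · rw [hnest' z hz j hj]
      exact (hle j hj).trans le_add_self
    · obtain ⟨i, rfl⟩ := Nat.exists_eq_add_of_le hj
      calc F (k + i) (c (k + i) z) ≤ ⨆ j, F (k + j) (c (k + j) z) :=
            le_iSup (fun j => F (k + j) (c (k + j) z)) i
        _ = ((⨆ j, F (k + j) (c (k + j) z)) - F k (c k x)) + F k (c k x) :=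
            (tsub_add_cancel_of_le hkx).symm
        _ ≤ _ := by gcongr; exact hle k le_rfl
  have h2 : ∫⁻ z in c k ⁻¹' {c k x}, ((⨆ j, F (k + j) (c (k + j) z)) - F k (c k x)) ∂μ =
      (∫⁻ z in c k ⁻¹' {c k x}, ⨆ j, F (k + j) (c (k + j) z) ∂μ) -
        F k (c k x) * μ (c k ⁻¹' {c k x}) := by
    rw [lintegral_sub measurable_const, setLIntegral_const]
    · rw [setLIntegral_const]; exact ENNReal.mul_ne_top hE hfin
    · refine (ae_restrict_iff' hms).2 (.of_forall fun z hz => ?_)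
      refine le_trans ?_ (le_iSup _ 0)
      have : c k z = c k x := hz
      simp [this]
  have h3 : μ (c k ⁻¹' {c k x}) ≤
      C * μ ({z | t < ⨆ j, F j (c j z)} ∩ c k ⁻¹' {c k x}) := by
    obtain ⟨y, hy, hty⟩ := hex
    refine (hdoub y hy).trans ?_
    gcongr
    intro z (hz : c (k + 1) z = c (k + 1) y)
    refine ⟨?_, (hnest k z y hz).trans hy⟩
    refine hty.trans_le ?_
    rw [← hz]
    exact le_iSup (fun j => F j (c j z)) (k + 1)
  calc _ ≤ _ := h1
    _ = _ := h2
    _ ≤ δ * (F k (c k x) * μ (c k ⁻¹' {c k x})) - 1 * (F k (c k x) * μ (c k ⁻¹' {c k x})) := by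
      rw [one_mul]; gcongr
    _ = (δ - 1) * (F k (c k x) * μ (c k ⁻¹' {c k x})) := by
      rw [ENNReal.sub_mul]; exact fun _ _ => ENNReal.mul_ne_top hE hfin
    _ ≤ (δ - 1) * (t * (C * μ ({z | t < ⨆ j, F j (c j z)} ∩ c k ⁻¹' {c k x}))) := by
      gcongr; exact hle k le_rfl
    _ = _ := by ring

theorem lintegral_iSup_sub_le {X ι : Type*} [MeasurableSpace X] {μ : Measure X}
    [MeasurableSpace ι] [Countable ι] [MeasurableSingletonClass ι]
    {c : ℕ → X → ι} (hc : ∀ k, Measurable (c k))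
    (hnest : ∀ k x y, c (k + 1) x = c (k + 1) y → c k x = c k y)
    {C δ t : ℝ≥0∞} (ht : t ≠ ∞) {F : ℕ → ι → ℝ≥0∞}
    (hfin : ∀ k x, μ (c k ⁻¹' {c k x}) ≠ ∞)
    (hdoub : ∀ k x y, c k y = c k x →
      μ (c k ⁻¹' {c k x}) ≤ C * μ (c (k + 1) ⁻¹' {c (k + 1) y}))
    (hFW : ∀ k x, ∫⁻ z in c k ⁻¹' {c k x}, ⨆ j, F (k + j) (c (k + j) z) ∂μ ≤
      δ * (F k (c k x) * μ (c k ⁻¹' {c k x})))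
    (x₀ : X) (hx₀ : F 0 (c 0 x₀) ≤ t) :
    ∫⁻ z in c 0 ⁻¹' {c 0 x₀}, ((⨆ j, F j (c j z)) - t) ∂μ ≤
      C * (δ - 1) * t * μ ({z | t < ⨆ j, F j (c j z)} ∩ c 0 ⁻¹' {c 0 x₀}) := by
  have hnest' : ∀ k x y, c k y = c k x → ∀ j ≤ k, c j y = c j x := by
    intro k x y hy j hj
    exact Nat.decreasingInduction (motive := fun j _ => c j y = c j x)
      (fun i _ h => hnest i y x h) hy hj
  have hFm : ∀ j, Measurable fun z => F j (c j z) := fun j =>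
    (Measurable.of_discrete (f := F j)).comp (hc j)
  set B := c 0 ⁻¹' {c 0 x₀}
  set P : ℕ → X → Prop := fun k z => ∃ y, c k y = c k z ∧ t < F (k + 1) (c (k + 1) y)
  have hP : ∀ k z z', c k z = c k z' → (P k z ↔ P k z') := by
    intro k z z' h
    simp only [P, h]
  let A : ℕ × ι → Set X := fun p =>
    {z | z ∈ B ∧ c p.1 z = p.2 ∧ P p.1 z ∧ ∀ j < p.1, ¬ P j z}
  have hA : ∀ p, ∀ x ∈ A p, A p = c p.1 ⁻¹' {c p.1 x} := by
    rintro ⟨k, v⟩ x ⟨hxB, hxv, hPx, hnx⟩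
    simp only at hxv hPx hnx
    subst hxv
    ext z
    constructor
    · rintro ⟨_, h, _⟩; exact h
    · intro (h : c k z = c k x)
      refine ⟨(hnest' k x z h 0 k.zero_le).trans hxB, h, (hP k z x h).2 hPx, fun j hj => ?_⟩
      rw [hP j z x (hnest' k x z h j hj.le)]
      exact hnx j hj
  have hAm : ∀ p, MeasurableSet (A p) := by
    intro p
    rcases (A p).eq_empty_or_nonempty with h | ⟨x, hx⟩
    · rw [h]; exact .empty
    · rw [hA p x hx]; exact hc _ (measurableSet_singleton _)
  have hAd : Pairwise (Function.onFun Disjoint A) := by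
    rintro ⟨k, v⟩ ⟨l, u⟩ hne
    refine Set.disjoint_left.2 ?_
    rintro z ⟨_, h1, h2, h3⟩ ⟨_, h1', h2', h3'⟩
    simp only at h1 h2 h3 h1' h2' h3'
    have : k = l := by
      rcases lt_trichotomy k l with h | h | h
      · exact absurd h2 (h3' k h)
      · exact h
      · exact absurd h2' (h3 l h)
    subst this
    exact hne (by rw [← h1, ← h1'])
  have hAle : ∀ p, ∫⁻ z in A p, ((⨆ j, F j (c j z)) - t) ∂μ ≤
      C * (δ - 1) * t * μ ({z | t < ⨆ j, F j (c j z)} ∩ A p) := by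
    intro p
    rcases (A p).eq_empty_or_nonempty with h | ⟨x, hx⟩
    · simp [h]
    · rw [hA p x hx]
      obtain ⟨hxB, _, hPx, hnx⟩ := hx
      refine lintegral_iSup_sub_le_of_cell hc hnest ht _ x (hfin _ _) (hdoub _ _) (hFW _ _) ?_ hPx
      intro j hj
      rcases j with _ | j
      · rw [show c 0 x = c 0 x₀ from hxB]; exact hx₀
      · by_contra! h
        exact hnx j hj ⟨x, rfl, h⟩
  have hcov : ∀ z ∈ B, z ∉ ⋃ p, A p → (⨆ j, F j (c j z)) - t = 0 := by
    intro z hz hzA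
    refine tsub_eq_zero_of_le (iSup_le fun j => ?_)
    rcases j with _ | j
    · rw [show c 0 z = c 0 x₀ from hz]; exact hx₀
    · by_contra! h
      classical
      have hex : ∃ k, P k z := ⟨j, z, rfl, h⟩
      exact hzA (mem_iUnion.2 ⟨(Nat.find hex, c (Nat.find hex) z), hz, rfl,
        Nat.find_spec hex, fun i hi => Nat.find_min hex hi⟩)
  have hBm : MeasurableSet B := hc 0 (measurableSet_singleton _)
  have hUm : MeasurableSet (⋃ p, A p) := .iUnion hAm
  have hΩ : MeasurableSet {z | t < ⨆ j, F j (c j z)} :=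
    measurableSet_lt measurable_const (.iSup hFm)
  calc ∫⁻ z in B, ((⨆ j, F j (c j z)) - t) ∂μ
      ≤ ∫⁻ z in ⋃ p, A p, ((⨆ j, F j (c j z)) - t) ∂μ := by
        rw [← lintegral_indicator hBm, ← lintegral_indicator hUm]
        refine lintegral_mono fun z => ?_
        by_cases hz : z ∈ B <;> by_cases hzA : z ∈ ⋃ p, A p
        · simp only [indicator_of_mem hz, indicator_of_mem hzA, le_refl]
        · simp only [indicator_of_mem hz, hcov z hz hzA, zero_le]
        · simp only [indicator_of_notMem hz, zero_le]
        · simp only [indicator_of_notMem hz, zero_le]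
    _ = ∑' p, ∫⁻ z in A p, ((⨆ j, F j (c j z)) - t) ∂μ := lintegral_iUnion hAm hAd _
    _ ≤ ∑' p, C * (δ - 1) * t * μ ({z | t < ⨆ j, F j (c j z)} ∩ A p) :=
        ENNReal.tsum_le_tsum hAle
    _ = C * (δ - 1) * t * μ (⋃ p, {z | t < ⨆ j, F j (c j z)} ∩ A p) := by
        rw [ENNReal.tsum_mul_left, measure_iUnion _ fun p => hΩ.inter (hAm p)]
        exact fun p q h => (hAd h).mono inter_subset_right inter_subset_right
    _ ≤ _ := by
        gcongr
        refine iUnion_subset fun p => inter_subset_inter_right _ ?_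
        exact fun z hz => hz.1


theorem integral_rpow_sub_le {X : Type*} [MeasurableSpace X] {μ : Measure X} [IsFiniteMeasure μ]
    {f : X → ℝ} (hf : Measurable f) {m N K ε : ℝ} (hm : 0 < m) (hK : 0 ≤ K) (hε : 0 ≤ ε)
    (hmf : ∀ᵐ x ∂μ, m ≤ f x) (hfN : ∀ᵐ x ∂μ, f x ≤ N)
    (h : ∀ t, m < t → ∫⁻ x, ENNReal.ofReal (f x - t) ∂μ ≤ ENNReal.ofReal (K * t) * μ {x | t < f x}) :
    (1 - K * ε) * ∫ x, (f x ^ (1 + ε) - m ^ (1 + ε)) ∂μ ≤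
      (1 + ε) * m ^ ε * ∫ x, (f x - m) ∂μ := by
  have hε1 : 0 < 1 + ε := by linarith
  have key : ∫⁻ x, (∫⁻ t in Ioi m, ENNReal.ofReal (ε * t ^ (ε - 1)) * ENNReal.ofReal (f x - t)) ∂μ ≤
      ∫⁻ x, (∫⁻ t in Ioi m, ENNReal.ofReal (ε * t ^ (ε - 1)) * (ENNReal.ofReal (K * t) *
        {x | t < f x}.indicator (fun _ => 1) x)) ∂μ := by
    have hmeas : MeasurableSet {p : X × ℝ | p.2 < f p.1} := by
      measurability
    refine (lintegral_lintegral_swap ?_).trans_le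
      (le_trans ?_ (lintegral_lintegral_swap ?_).symm.le)
    · refine Measurable.aemeasurable ?_
      refine Measurable.mul (f := fun p : X × ℝ => ENNReal.ofReal (ε * p.2 ^ (ε - 1)))
        (g := fun p : X × ℝ => ENNReal.ofReal (f p.1 - p.2)) (by fun_prop) (by fun_prop)
    · refine setLIntegral_mono' measurableSet_Ioi fun t ht => ?_
      rw [lintegral_const_mul _ (by fun_prop), lintegral_const_mul, lintegral_const_mul]
      · gcongr
        refine (h t ht).trans_eq ?_
        congr 1
        exact (lintegral_indicator_one (measurableSet_lt measurable_const hf)).symm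
      · exact measurable_const.indicator (measurableSet_lt measurable_const hf)
      · exact (measurable_const.indicator (measurableSet_lt measurable_const hf)).const_mul _
    · refine Measurable.aemeasurable ?_
      refine Measurable.mul (f := fun p : X × ℝ => ENNReal.ofReal (ε * p.2 ^ (ε - 1)))
        (by fun_prop) (Measurable.mul (f := fun p : X × ℝ => ENNReal.ofReal (K * p.2))
          (by fun_prop) ?_)
      exact (measurable_const (a := (1 : ℝ≥0∞))).indicator hmeas
  have hL : ∀ y, m ≤ y → ∫⁻ t in Ioi m, ENNReal.ofReal (ε * t ^ (ε - 1)) * ENNReal.ofReal (y - t) =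
      ENNReal.ofReal ((y ^ (1 + ε) - m ^ (1 + ε)) / (1 + ε) - m ^ ε * (y - m)) := by
    intro y hy
    have hcont : ContinuousOn (fun t : ℝ => ε * t ^ (ε - 1) * (y - t)) (uIcc m y) := by
      rw [uIcc_of_le hy]
      refine ContinuousOn.mul (continuousOn_const.mul (ContinuousOn.rpow_const continuousOn_id ?_))
        (by fun_prop)
      exact fun t ht => Or.inl (hm.trans_le ht.1).ne'
    have h1 : ∫ t in m..y, ε * t ^ (ε - 1) * (y - t) =
        (y ^ (1 + ε) - m ^ (1 + ε)) / (1 + ε) - m ^ ε * (y - m) := by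
      rw [intervalIntegral.integral_eq_sub_of_hasDerivAt
        (f := fun t => t ^ ε * (y - t) + t ^ (1 + ε) / (1 + ε)) _ hcont.intervalIntegrable]
      · ring
      · intro t ht
        rw [uIcc_of_le hy] at ht
        have ht0 : t ≠ 0 := (hm.trans_le ht.1).ne'
        have := ((Real.hasDerivAt_rpow_const (p := ε) (Or.inl ht0)).mul
          ((hasDerivAt_id t).const_sub y)).add
          ((Real.hasDerivAt_rpow_const (p := 1 + ε) (Or.inl ht0)).div_const (1 + ε))
        refine this.congr_deriv ?_
        simp only [id, show 1 + ε - 1 = ε by ring]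
        field_simp
        ring
    rw [← h1, intervalIntegral.integral_of_le hy, ofReal_integral_eq_lintegral_ofReal]
    · rw [← Ioc_union_Ioi_eq_Ioi hy, lintegral_union measurableSet_Ioi Ioc_disjoint_Ioi_same]
      rw [setLIntegral_congr_fun (g := fun _ => 0) measurableSet_Ioi, lintegral_zero, add_zero]
      · refine setLIntegral_congr_fun measurableSet_Ioc fun t ht => ?_
        have : 0 < t := hm.trans ht.1
        change _ = ENNReal.ofReal (ε * t ^ (ε - 1) * (y - t))
        rw [← ENNReal.ofReal_mul (by positivity)]
      · intro t (ht : y < t)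
        simp [ht.le]
    · exact hcont.intervalIntegrable.1
    · refine (ae_restrict_iff' measurableSet_Ioc).2 (.of_forall fun t ht => ?_)
      have : 0 < t := hm.trans ht.1
      have : 0 ≤ y - t := sub_nonneg.2 ht.2
      simp only [Pi.zero_apply]
      positivity
  have hR : ∀ y, m ≤ y → ∫⁻ t in Ioi m, ENNReal.ofReal (ε * t ^ (ε - 1)) *
        (ENNReal.ofReal (K * t) * {t | t < y}.indicator (fun _ => 1) t) ≤
      ENNReal.ofReal (K * ε * ((y ^ (1 + ε) - m ^ (1 + ε)) / (1 + ε))) := by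
    intro y hy
    have hcont : ContinuousOn (fun t : ℝ => K * ε * t ^ ε) (uIcc m y) :=
      continuousOn_const.mul (ContinuousOn.rpow_const continuousOn_id fun t ht => Or.inr hε)
    have h1 : ∫ t in m..y, K * ε * t ^ ε =
        K * ε * ((y ^ (1 + ε) - m ^ (1 + ε)) / (1 + ε)) := by
      rw [intervalIntegral.integral_const_mul, integral_rpow (Or.inl (by linarith)), add_comm ε 1]
    rw [← h1, intervalIntegral.integral_of_le hy, ofReal_integral_eq_lintegral_ofReal]
    · rw [← Ioc_union_Ioi_eq_Ioi hy, lintegral_union measurableSet_Ioi Ioc_disjoint_Ioi_same]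
      rw [setLIntegral_congr_fun (g := fun _ => 0) measurableSet_Ioi, lintegral_zero, add_zero]
      · refine setLIntegral_mono' measurableSet_Ioc fun t ht => ?_
        have ht0 : 0 < t := hm.trans ht.1
        calc _ ≤ ENNReal.ofReal (ε * t ^ (ε - 1)) * (ENNReal.ofReal (K * t) * 1) := by
              gcongr
              exact indicator_le_self' (fun _ _ => zero_le) t
          _ = ENNReal.ofReal (K * ε * t ^ ε) := by
              rw [mul_one, ← ENNReal.ofReal_mul (by positivity), Real.rpow_sub_one ht0.ne']
              congr 1
              field_simp
      · intro t (ht : y < t)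
        simp [ht.le]
    · exact hcont.intervalIntegrable.1
    · refine (ae_restrict_iff' measurableSet_Ioc).2 (.of_forall fun t ht => ?_)
      have : 0 < t := hm.trans ht.1
      simp only [Pi.zero_apply]
      positivity
  have hint1 : Integrable f μ := by
    refine Integrable.of_bound hf.aestronglyMeasurable N ?_
    filter_upwards [hmf, hfN] with x h1 h2
    rwa [Real.norm_of_nonneg (hm.le.trans h1)]
  have hint2 : Integrable (fun x => f x ^ (1 + ε)) μ := by
    refine Integrable.of_bound (hf.pow_const _).aestronglyMeasurable (N ^ (1 + ε)) ?_
    filter_upwards [hmf, hfN] with x h1 h2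
    have h0 : 0 ≤ f x := hm.le.trans h1
    rw [Real.norm_of_nonneg (by positivity)]
    gcongr
  have hI1 : Integrable (fun x => f x ^ (1 + ε) - m ^ (1 + ε)) μ :=
    hint2.sub (integrable_const _)
  have hI2 : Integrable (fun x => f x - m) μ := hint1.sub (integrable_const _)
  have hmono : ∀ y, m ≤ y → m ^ (1 + ε) ≤ y ^ (1 + ε) := fun y hy => by gcongr
  have hnn : 0 ≤ ∫ x, K * ε * ((f x ^ (1 + ε) - m ^ (1 + ε)) / (1 + ε)) ∂μ := by
    refine integral_nonneg_of_ae ?_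
    filter_upwards [hmf] with x hx
    have := sub_nonneg.2 (hmono _ hx)
    simp only [Pi.zero_apply]
    positivity
  have hmain : ∫ x, ((f x ^ (1 + ε) - m ^ (1 + ε)) / (1 + ε) - m ^ ε * (f x - m)) ∂μ ≤
      ∫ x, K * ε * ((f x ^ (1 + ε) - m ^ (1 + ε)) / (1 + ε)) ∂μ := by
    refine (ENNReal.ofReal_le_ofReal_iff hnn).1 ?_
    have hI3 : Integrable (fun x => (f x ^ (1 + ε) - m ^ (1 + ε)) / (1 + ε) - m ^ ε * (f x - m)) μ :=
      (hI1.div_const _).sub (hI2.const_mul _)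
    rw [integral_eq_lintegral_pos_part_sub_lintegral_neg_part hI3]
    refine (ENNReal.ofReal_le_ofReal (sub_le_self _ ENNReal.toReal_nonneg)).trans
      (ENNReal.ofReal_toReal_le.trans ?_)
    rw [ofReal_integral_eq_lintegral_ofReal ((hI1.div_const _).const_mul _)]
    · calc _ ≤ _ := (lintegral_congr_ae (hmf.mono fun x hx => hL _ hx)).symm.le
        _ ≤ _ := key
        _ ≤ _ := lintegral_mono_ae (hmf.mono fun x hx => hR _ hx)
    · filter_upwards [hmf] with x hx
      have := sub_nonneg.2 (hmono _ hx)
      simp only [Pi.zero_apply]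
      positivity
  rw [integral_sub (hI1.div_const _) (hI2.const_mul _), integral_const_mul, integral_const_mul,
    integral_div] at hmain
  field_simp at hmain
  linarith

/-- The half-open dyadic subcube of generation `k` and position `v` of the cube with corner `a`
and side length `s`. -/
def dyadicCell {n : ℕ} (a : Fin n → ℝ) (s : ℝ) (k : ℕ) (v : Fin n → ℤ) : Set (Fin n → ℝ) :=
  Set.univ.pi fun i => Set.Ico (a i + s / 2 ^ k * v i) (a i + s / 2 ^ k * v i + s / 2 ^ k)

/-- The position of the dyadic subcube of generation `k` containing `x`. -/
def dyadicIndex {n : ℕ} (a : Fin n → ℝ) (s : ℝ) (k : ℕ) (x : Fin n → ℝ) : Fin n → ℤ :=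
  fun i => ⌊(x i - a i) / (s / 2 ^ k)⌋

section Dyadic

variable {n : ℕ} {a : Fin n → ℝ} {s : ℝ}

theorem measurable_dyadicIndex (a : Fin n → ℝ) (s : ℝ) (k : ℕ) :
    Measurable (dyadicIndex a s k) := by
  refine measurable_pi_lambda _ fun i => Int.measurable_floor.comp ?_
  fun_prop

theorem dyadicIndex_preimage_singleton (hs : 0 < s) (k : ℕ) (v : Fin n → ℤ) :
    dyadicIndex a s k ⁻¹' {v} = dyadicCell a s k v := by
  ext x
  have hk : 0 < s / 2 ^ k := by positivity
  simp only [mem_preimage, mem_singleton_iff, dyadicIndex, dyadicCell, mem_univ_pi, mem_Ico,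
    funext_iff, Int.floor_eq_iff, le_div_iff₀ hk, div_lt_iff₀ hk]
  refine forall_congr' fun i => and_congr ?_ ?_ <;> constructor <;> intro h <;> linarith

theorem dyadicIndex_eq_ediv (k : ℕ) (x : Fin n → ℝ) (i : Fin n) :
    dyadicIndex a s k x i = dyadicIndex a s (k + 1) x i / 2 := by
  have := Int.floor_div_natCast ((x i - a i) / (s / 2 ^ (k + 1))) 2
  simp only [dyadicIndex]
  push_cast at this
  rw [← this]
  congr 1
  rw [pow_succ]
  field_simp

theorem dyadicIndex_nested (k : ℕ) (x y : Fin n → ℝ)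
    (h : dyadicIndex a s (k + 1) x = dyadicIndex a s (k + 1) y) :
    dyadicIndex a s k x = dyadicIndex a s k y := by
  ext i
  rw [dyadicIndex_eq_ediv, dyadicIndex_eq_ediv k y, h]

theorem mem_dyadicCell_dyadicIndex (hs : 0 < s) (k : ℕ) (x : Fin n → ℝ) :
    x ∈ dyadicCell a s k (dyadicIndex a s k x) := by
  rw [← dyadicIndex_preimage_singleton hs]
  rfl

theorem dyadicCell_dyadicIndex_subset (hs : 0 < s) {k l : ℕ} (h : k ≤ l) (x : Fin n → ℝ) :
    dyadicCell a s l (dyadicIndex a s l x) ⊆ dyadicCell a s k (dyadicIndex a s k x) := by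
  induction l, h using Nat.le_induction with
  | base => rfl
  | succ l _ ih =>
    refine subset_trans ?_ ih
    simp only [← dyadicIndex_preimage_singleton hs]
    exact fun z hz => dyadicIndex_nested l z x hz

theorem measurableSet_dyadicCell (a : Fin n → ℝ) (s : ℝ) (k : ℕ) (v : Fin n → ℤ) :
    MeasurableSet (dyadicCell a s k v) :=
  .univ_pi fun _ => measurableSet_Ico

theorem interior_dyadicCell (k : ℕ) (v : Fin n → ℤ) :
    interior (dyadicCell a s k v) = Set.univ.pi fun i =>
      Set.Ioo (a i + s / 2 ^ k * v i) (a i + s / 2 ^ k * v i + s / 2 ^ k) := by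
  simp only [dyadicCell, interior_pi_set finite_univ, interior_Ico]

theorem isCube_interior_dyadicCell (hs : 0 < s) (k : ℕ) (v : Fin n → ℤ) :
    IsCube (interior (dyadicCell a s k v)) :=
  ⟨fun i => a i + s / 2 ^ k * v i, s / 2 ^ k, by positivity, interior_dyadicCell k v⟩

theorem dyadicCell_ae_eq_Icc (k : ℕ) (v : Fin n → ℤ) :
    dyadicCell a s k v =ᵐ[volume] Icc (fun i => a i + s / 2 ^ k * v i)
      (fun i => a i + s / 2 ^ k * v i + s / 2 ^ k) :=
  Measure.univ_pi_Ico_ae_eq_Icc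

theorem interior_dyadicCell_ae_eq (k : ℕ) (v : Fin n → ℤ) :
    interior (dyadicCell a s k v) =ᵐ[volume] dyadicCell a s k v := by
  rw [interior_dyadicCell]
  exact Measure.univ_pi_Ioo_ae_eq_Icc.trans (dyadicCell_ae_eq_Icc k v).symm

theorem volume_dyadicCell (k : ℕ) (v : Fin n → ℤ) :
    volume (dyadicCell a s k v) = ENNReal.ofReal (s / 2 ^ k) ^ n := by
  simp [dyadicCell, Real.volume_pi_Ico]

theorem volume_dyadicCell_ne_top (k : ℕ) (v : Fin n → ℤ) :
    volume (dyadicCell a s k v) ≠ ∞ := by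
  rw [volume_dyadicCell]
  exact ENNReal.pow_ne_top ENNReal.ofReal_ne_top

theorem volume_dyadicCell_ne_zero (hs : 0 < s) (k : ℕ) (v : Fin n → ℤ) :
    volume (dyadicCell a s k v) ≠ 0 := by
  rw [volume_dyadicCell]
  refine pow_ne_zero _ (ENNReal.ofReal_pos.2 ?_).ne'
  positivity

theorem volume_dyadicCell_eq_two_pow_mul (k : ℕ) (u v : Fin n → ℤ) :
    volume (dyadicCell a s k u) = 2 ^ n * volume (dyadicCell a s (k + 1) v) := by
  rw [volume_dyadicCell, volume_dyadicCell, ← mul_pow]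
  congr 1
  rw [← ENNReal.ofReal_ofNat, ← ENNReal.ofReal_mul (by norm_num), pow_succ]
  congr 1
  field_simp

theorem ae_mem_interior_dyadicCell (hs : 0 < s) :
    ∀ᵐ x : Fin n → ℝ, ∀ k, x ∈ interior (dyadicCell a s k (dyadicIndex a s k x)) := by
  rw [ae_all_iff]
  intro k
  have : ∀ v : Fin n → ℤ, ∀ᵐ x : Fin n → ℝ,
      x ∈ dyadicCell a s k v → x ∈ interior (dyadicCell a s k v) := by
    intro v
    filter_upwards [interior_dyadicCell_ae_eq (a := a) (s := s) k v] with x hx h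
    exact hx.mpr h
  filter_upwards [ae_all_iff.2 this] with x hx
  exact hx _ (mem_dyadicCell_dyadicIndex hs k x)

variable {w : (Fin n → ℝ) → ℝ}

theorem setLIntegral_dyadicCell_ne_top (hloc : LocallyIntegrable w volume) (k : ℕ)
    (v : Fin n → ℤ) :
    ∫⁻ y in dyadicCell a s k v, ENNReal.ofReal (w y) ≠ ∞ := by
  rw [setLIntegral_congr (dyadicCell_ae_eq_Icc k v)]
  have := hloc.integrableOn_isCompact (isCompact_Icc (a := fun i => a i + s / 2 ^ k * v i)
    (b := fun i => a i + s / 2 ^ k * v i + s / 2 ^ k))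
  exact this.lintegral_lt_top.ne

theorem setLAverage_dyadicCell_mul_volume (hs : 0 < s) (k : ℕ) (v : Fin n → ℤ)
    (g : (Fin n → ℝ) → ℝ≥0∞) :
    (∫⁻ y in dyadicCell a s k v, g y) / volume (dyadicCell a s k v) *
      volume (dyadicCell a s k v) = ∫⁻ y in dyadicCell a s k v, g y :=
  ENNReal.div_mul_cancel (volume_dyadicCell_ne_zero hs k v) (volume_dyadicCell_ne_top k v)

theorem lintegral_iSup_average_dyadicCell_le (hw : ∀ x, 0 ≤ w x) {δ : ℝ≥0∞}
    (hFW : ∀ Q : Set (Fin n → ℝ), IsCube Q →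
      (∫⁻ x in Q, maximal (Q.indicator w) x) ≤ δ * ∫⁻ x in Q, ENNReal.ofReal (w x))
    (hs : 0 < s) (k : ℕ) (x : Fin n → ℝ) :
    ∫⁻ z in dyadicCell a s k (dyadicIndex a s k x),
        ⨆ j, (∫⁻ y in dyadicCell a s (k + j) (dyadicIndex a s (k + j) z), ENNReal.ofReal (w y)) /
          volume (dyadicCell a s (k + j) (dyadicIndex a s (k + j) z)) ≤
      δ * ∫⁻ y in dyadicCell a s k (dyadicIndex a s k x), ENNReal.ofReal (w y) := by
  set D := dyadicCell a s k (dyadicIndex a s k x)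
  rw [← setLIntegral_congr (interior_dyadicCell_ae_eq k (dyadicIndex a s k x)),
    ← setLIntegral_congr (interior_dyadicCell_ae_eq k (dyadicIndex a s k x))]
  refine le_trans ?_ (hFW _ (isCube_interior_dyadicCell hs k _))
  refine setLIntegral_mono_ae' isOpen_interior.measurableSet ?_
  filter_upwards [ae_mem_interior_dyadicCell (a := a) hs] with z hz hzD
  refine iSup_le fun j => ?_
  set E := dyadicCell a s (k + j) (dyadicIndex a s (k + j) z)
  have hED : E ⊆ D := by
    refine (dyadicCell_dyadicIndex_subset hs (Nat.le_add_right k j) z).trans ?_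
    have : z ∈ dyadicIndex a s k ⁻¹' {dyadicIndex a s k x} := by
      rw [dyadicIndex_preimage_singleton hs]; exact interior_subset hzD
    rw [show dyadicIndex a s k z = dyadicIndex a s k x from this]
  have hEE : interior E =ᵐ[volume] E := interior_dyadicCell_ae_eq _ _
  rw [← setLIntegral_congr hEE, ← measure_congr hEE]
  refine le_trans (le_of_eq ?_) (le_iSup_of_le (interior E) <| le_iSup_of_le
    (isCube_interior_dyadicCell hs (k + j) _) <| le_iSup_of_le (hz (k + j)) le_rfl)
  congr 1
  refine setLIntegral_congr_fun isOpen_interior.measurableSet fun y hy => ?_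
  rw [indicator_of_mem (interior_mono hED hy), abs_of_nonneg (hw y)]

theorem ae_le_iSup_average_dyadicCell (hw : ∀ x, 0 ≤ w x) (hloc : LocallyIntegrable w volume)
    (hs : 0 < s) :
    ∀ᵐ x : Fin n → ℝ, ENNReal.ofReal (w x) ≤
      ⨆ k, (∫⁻ y in dyadicCell a s k (dyadicIndex a s k x), ENNReal.ofReal (w y)) /
          volume (dyadicCell a s k (dyadicIndex a s k x)) := by
  filter_upwards [IsUnifLocDoublingMeasure.ae_tendsto_average (μ := volume) hloc 1] with x hx
  let ctr : ℕ → Fin n → ℝ := fun k i =>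
    a i + s / 2 ^ k * dyadicIndex a s k x i + s / 2 ^ k / 2
  have hball : ∀ k, Metric.closedBall (ctr k) (s / 2 ^ k / 2) =
      Icc (fun i => a i + s / 2 ^ k * dyadicIndex a s k x i)
        (fun i => a i + s / 2 ^ k * dyadicIndex a s k x i + s / 2 ^ k) := by
    intro k
    rw [closedBall_pi _ (by positivity), ← pi_univ_Icc]
    simp only [Real.closedBall_eq_Icc, ctr]
    congr 1; ext i; congr! 2 <;> ring
  have hlim : Filter.Tendsto (fun k : ℕ => s / 2 ^ k / 2) Filter.atTop (nhdsWithin 0 (Ioi 0)) := by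
    refine tendsto_nhdsWithin_iff.2 ⟨?_, .of_forall fun k => ?_⟩
    · have := (tendsto_pow_atTop_nhds_zero_of_lt_one (r := (1 / 2 : ℝ)) (by norm_num)
        (by norm_num)).const_mul (s / 2)
      rw [mul_zero] at this
      refine this.congr fun k => ?_
      rw [one_div, inv_pow]
      ring
    · exact mem_Ioi.2 (by positivity)
  have hconv := hx ctr _ hlim (.of_forall fun k => by
    rw [one_mul, hball, ← pi_univ_Icc]
    exact Set.pi_mono (fun i _ => Ico_subset_Icc_self) (mem_dyadicCell_dyadicIndex hs k x))
  refine le_of_tendsto ((ENNReal.continuous_ofReal.tendsto _).comp hconv) (.of_forall fun k => ?_)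
  refine le_iSup_of_le k (le_of_eq ?_)
  have hae := (dyadicCell_ae_eq_Icc (a := a) (s := s) k (dyadicIndex a s k x)).symm
  rw [← hball] at hae
  have hint : IntegrableOn w (dyadicCell a s k (dyadicIndex a s k x)) := by
    refine IntegrableOn.congr_set_ae ?_ hae.symm
    exact hloc.integrableOn_isCompact (isCompact_closedBall _ _)
  rw [Function.comp_apply, setAverage_congr hae, setAverage_eq, smul_eq_mul, mul_comm,
    ← div_eq_mul_inv, ENNReal.ofReal_div_of_pos, ofReal_integral_eq_lintegral_ofReal hint
      (.of_forall hw), Measure.real, ENNReal.ofReal_toReal (volume_dyadicCell_ne_top _ _)]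
  exact ENNReal.toReal_pos (volume_dyadicCell_ne_zero hs _ _) (volume_dyadicCell_ne_top _ _)

end Dyadic

/-- Asymptotically sharp reverse Hölder inequality for flat `A∞` weights in `ℝⁿ`
(Fujii–Wilson constant at most `δ`).  Here the constant
`δ (r'-1)/(r'-1-2ⁿ(δ-1))` is written in the equivalent form
`δ / (1 - 2ⁿ(δ-1)(r-1))`, valid also at `r = 1`. -/
theorem stmt0 {n : ℕ} (w : (Fin n → ℝ) → ℝ) (hw : ∀ x, 0 ≤ w x)
    (hloc : LocallyIntegrable w volume) (δ : ℝ) (hδ : 1 < δ)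
    (hFW : ∀ Q : Set (Fin n → ℝ), IsCube Q →
      (∫⁻ x in Q, maximal (Q.indicator w) x) ≤
        ENNReal.ofReal δ * ∫⁻ x in Q, ENNReal.ofReal (w x))
    (Q : Set (Fin n → ℝ)) (hQ : IsCube Q) (r : ℝ) (hr1 : 1 ≤ r)
    (hr2 : r < 1 + 1 / (2 ^ n * (δ - 1))) :
    (∫⁻ x in Q, ENNReal.ofReal (w x ^ r)) / volume Q ≤
      ENNReal.ofReal (δ * (1 / (1 - 2 ^ n * (δ - 1) * (r - 1)))) *
        ((∫⁻ x in Q, ENNReal.ofReal (w x)) / volume Q) ^ r := by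
  obtain ⟨a, s, hs, rfl⟩ := hQ
  set Q := Set.univ.pi fun i => Set.Ioo (a i) (a i + s) with hQdef
  have hindex : dyadicIndex a s 0 a = 0 := by
    ext i
    simp [dyadicIndex]
  set B := dyadicCell a s 0 0
  have hcell0 : dyadicIndex a s 0 ⁻¹' {dyadicIndex a s 0 a} = B := by
    rw [dyadicIndex_preimage_singleton hs, hindex]
  have hQB : Q =ᵐ[volume] B := by
    have : Q = interior B := by rw [interior_dyadicCell]; simp [hQdef]
    rw [this]
    exact interior_dyadicCell_ae_eq 0 0
  have hvol0 : volume B ≠ 0 := volume_dyadicCell_ne_zero hs 0 0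
  have hvolt : volume B ≠ ∞ := volume_dyadicCell_ne_top 0 0
  have hwB : ∫⁻ y in B, ENNReal.ofReal (w y) ≠ ∞ := setLIntegral_dyadicCell_ne_top hloc 0 0
  rw [setLIntegral_congr hQB, setLIntegral_congr hQB, measure_congr hQB]
  have hmne : (∫⁻ y in B, ENNReal.ofReal (w y)) / volume B ≠ ∞ := ENNReal.div_ne_top hwB hvol0
  set m := ((∫⁻ y in B, ENNReal.ofReal (w y)) / volume B).toReal
  have hmE : (∫⁻ y in B, ENNReal.ofReal (w y)) / volume B = ENNReal.ofReal m :=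
    (ENNReal.ofReal_toReal hmne).symm
  have hwm : AEMeasurable w := hloc.aestronglyMeasurable.aemeasurable
  have hpow : (0 : ℝ) < 2 ^ n * (δ - 1) := by
    have := sub_pos.2 hδ
    positivity
  set K := 2 ^ n * (δ - 1) with hK
  set ε := r - 1
  have hr : r = 1 + ε := by ring
  have hε0 : 0 ≤ ε := sub_nonneg.2 hr1
  have hKε : 0 < 1 - K * ε := by
    have : ε < 1 / K := by linarith
    rw [lt_div_iff₀ hpow] at this
    linarith
  have hm_nonneg : 0 ≤ m := ENNReal.toReal_nonneg
  rcases hm_nonneg.eq_or_lt with hm0 | hm0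
  · -- The weight vanishes almost everywhere on the cube.
    rw [← hm0, ENNReal.ofReal_zero, ENNReal.div_eq_zero_iff, or_iff_left hvolt,
      lintegral_eq_zero_iff' hwm.restrict.ennreal_ofReal] at hmE
    have : ∫⁻ x in B, ENNReal.ofReal (w x ^ r) = 0 := by
      rw [lintegral_eq_zero_iff' (hwm.pow_const r).restrict.ennreal_ofReal]
      filter_upwards [hmE] with x hx
      have : w x = 0 := le_antisymm (ENNReal.ofReal_eq_zero.1 hx) (hw x)
      simp [this, Real.zero_rpow (show r ≠ 0 by linarith)]
    simp [this]
  rw [hmE]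
  let F : ℕ → (Fin n → ℤ) → ℝ≥0∞ := fun k v =>
    (∫⁻ y in dyadicCell a s k v, ENNReal.ofReal (w y)) / volume (dyadicCell a s k v)
  let M : (Fin n → ℝ) → ℝ≥0∞ := fun x => ⨆ k, F k (dyadicIndex a s k x)
  have hMm : Measurable M := .iSup fun k =>
    (Measurable.of_discrete (f := F k)).comp (measurable_dyadicIndex a s k)
  have hBm : MeasurableSet B := measurableSet_dyadicCell a s 0 0
  have hBidx : ∀ x ∈ B, dyadicIndex a s 0 x = 0 := by
    intro x hx
    rw [← hcell0, hindex] at hx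
    exact hx
  have hMge : ∀ x ∈ B, ENNReal.ofReal m ≤ M x := by
    intro x hx
    refine le_iSup_of_le 0 ?_
    simp only [F, hBidx x hx]
    exact hmE.ge
  have hFWM := lintegral_iSup_average_dyadicCell_le (a := a) hw hFW hs
  have hMint : ∫⁻ x in B, M x ≤ ENNReal.ofReal δ * (ENNReal.ofReal m * volume B) := by
    have := hFWM 0 a
    simp only [hindex, zero_add] at this
    rwa [← hmE, ENNReal.div_mul_cancel hvol0 hvolt]
  have hMlevel : ∀ t, m < t → ∫⁻ x in B, (M x - ENNReal.ofReal t) ≤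
      ENNReal.ofReal (K * t) * volume ({x | ENNReal.ofReal t < M x} ∩ B) := by
    intro t ht
    have hvc : ∀ k x, volume (dyadicIndex a s k ⁻¹' {dyadicIndex a s k x}) ≠ ∞ := by
      intro k x
      rw [dyadicIndex_preimage_singleton hs]
      exact volume_dyadicCell_ne_top _ _
    have := lintegral_iSup_sub_le (μ := volume) (C := 2 ^ n) (δ := ENNReal.ofReal δ)
      (t := ENNReal.ofReal t) (F := F) (measurable_dyadicIndex a s) dyadicIndex_nested
      ENNReal.ofReal_ne_top hvc (fun k x y _ => by
        simp only [dyadicIndex_preimage_singleton hs]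
        exact (volume_dyadicCell_eq_two_pow_mul k _ _).le) (fun k x => by
        simp only [dyadicIndex_preimage_singleton hs, F, setLAverage_dyadicCell_mul_volume hs]
        exact hFWM k x) a (by
        rw [hindex]
        exact hmE.le.trans (ENNReal.ofReal_le_ofReal ht.le))
    rw [hcell0] at this
    refine this.trans (le_of_eq ?_)
    congr 1
    rw [hK, ENNReal.ofReal_mul hpow.le, ENNReal.ofReal_mul (by positivity),
      ENNReal.ofReal_sub _ zero_le_one, ENNReal.ofReal_one, ENNReal.ofReal_pow zero_le_two,
      ENNReal.ofReal_ofNat]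
  have hwM : ∀ᵐ x, ENNReal.ofReal (w x) ≤ M x := ae_le_iSup_average_dyadicCell hw hloc hs
  have : IsFiniteMeasure (volume.restrict B) := ⟨by simpa using hvolt.lt_top⟩
  set b := volume.real B with hb
  have hbE : ENNReal.ofReal b = volume B := ENNReal.ofReal_toReal hvolt
  set A := δ * (1 / (1 - K * ε)) with hA
  have hA0 : 0 ≤ A := by positivity
  -- The estimate for the truncated weight.
  have htrunc : ∀ N : ℕ, ∫⁻ x in B, ENNReal.ofReal (min (w x) N ^ r) ≤
      ENNReal.ofReal (A * m ^ r * b) := by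
    intro N₀
    obtain ⟨N, hN₀, hmN⟩ : ∃ N : ℝ, N₀ ≤ N ∧ m ≤ N := ⟨max N₀ m, le_max_left _ _, le_max_right _ _⟩
    have hN0 : 0 ≤ N := hm0.le.trans hmN
    let f : (Fin n → ℝ) → ℝ := fun x => (min (M x) (ENNReal.ofReal N)).toReal
    have hf : Measurable f := (hMm.min measurable_const).ennreal_toReal
    have hfE : ∀ x, ENNReal.ofReal (f x) = min (M x) (ENNReal.ofReal N) := fun x =>
      ENNReal.ofReal_toReal (ne_top_of_le_ne_top ENNReal.ofReal_ne_top (min_le_right _ _))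
    have hfN : ∀ x, f x ≤ N := fun x => by
      rw [← ENNReal.ofReal_le_ofReal_iff hN0, hfE]
      exact min_le_right _ _
    have hmf : ∀ x ∈ B, m ≤ f x := fun x hx => by
      rw [← ENNReal.ofReal_le_ofReal_iff ENNReal.toReal_nonneg, hfE]
      exact le_min (hMge x hx) (ENNReal.ofReal_le_ofReal hmN)
    have hmf' : ∀ᵐ x ∂volume.restrict B, m ≤ f x :=
      (ae_restrict_iff' hBm).2 (.of_forall hmf)
    have hrev := integral_rpow_sub_le (μ := volume.restrict B) hf hm0 hpow.le hε0
      hmf' (.of_forall hfN) (K := K) (by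
      intro t ht
      have ht0 : 0 ≤ t := (hm0.trans ht).le
      rcases lt_or_ge t N with htN | htN
      · calc ∫⁻ x in B, ENNReal.ofReal (f x - t) ≤ ∫⁻ x in B, (M x - ENNReal.ofReal t) := by
              refine lintegral_mono fun x => ?_
              rw [ENNReal.ofReal_sub _ ht0, hfE]
              exact tsub_le_tsub_right (min_le_left _ _) _
          _ ≤ _ := hMlevel t ht
          _ = _ := by
              rw [Measure.restrict_apply (measurableSet_lt measurable_const hf)]
              congr 3
              ext x
              rw [mem_ofPred_eq, mem_ofPred_eq, ← ENNReal.ofReal_lt_ofReal_iff_of_nonneg ht0, hfE,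
                lt_min_iff, and_iff_left]
              exact (ENNReal.ofReal_lt_ofReal_iff_of_nonneg ht0).2 htN
      · have : ∀ x, ENNReal.ofReal (f x - t) = 0 := fun x =>
          ENNReal.ofReal_of_nonpos (by linarith [hfN x])
        simp [this])
    have hint1 : Integrable f (volume.restrict B) := by
      refine Integrable.of_bound hf.aestronglyMeasurable N (.of_forall fun x => ?_)
      rw [Real.norm_of_nonneg ENNReal.toReal_nonneg]
      exact hfN x
    have hint2 : Integrable (fun x => f x ^ (1 + ε)) (volume.restrict B) := by
      refine Integrable.of_bound (hf.pow_const _).aestronglyMeasurable (N ^ (1 + ε))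
        (.of_forall fun x => ?_)
      have h0 : 0 ≤ f x := ENNReal.toReal_nonneg
      rw [Real.norm_of_nonneg (by positivity)]
      gcongr
      exact hfN x
    have hfint : ∫ x in B, f x ≤ δ * (m * b) := by
      rw [← ENNReal.ofReal_le_ofReal_iff (by positivity),
        ofReal_integral_eq_lintegral_ofReal hint1 (.of_forall fun x => ENNReal.toReal_nonneg),
        ENNReal.ofReal_mul (by positivity), ENNReal.ofReal_mul hm0.le, hbE]
      refine le_trans (lintegral_mono fun x => ?_) hMint
      rw [hfE]
      exact min_le_left _ _
    rw [integral_sub hint2 (integrable_const _), integral_sub hint1 (integrable_const _),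
      integral_const, integral_const, measureReal_restrict_apply_univ, ← hb, smul_eq_mul,
      smul_eq_mul] at hrev
    have hfr : ∫ x in B, f x ^ (1 + ε) ≤ A * m ^ r * b := by
      have hmr : m ^ (1 + ε) = m ^ ε * m := by
        rw [add_comm, Real.rpow_add_one hm0.ne']
      have hb0 : 0 ≤ b := measureReal_nonneg
      have hKn : δ - 1 ≤ K := le_mul_of_one_le_left (by linarith) (one_le_pow₀ one_le_two)
      have h1 : (1 + ε) * m ^ ε * ((∫ x in B, f x) - b * m) ≤
          (1 + ε) * m ^ ε * ((δ - 1) * m * b) := by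
        gcongr
        linarith
      have hP : 0 ≤ m ^ ε * m * b := by positivity
      have h2 : ε * (δ - 1) * (m ^ ε * m * b) ≤ ε * K * (m ^ ε * m * b) := by gcongr
      rw [hr, hmr, hA, mul_one_div, div_mul_eq_mul_div, div_mul_eq_mul_div, le_div_iff₀ hKε]
      rw [hmr] at hrev
      linarith
    calc ∫⁻ x in B, ENNReal.ofReal (min (w x) N₀ ^ r)
        ≤ ∫⁻ x in B, ENNReal.ofReal (f x ^ (1 + ε)) := by
          refine lintegral_mono_ae (ae_restrict_of_ae ?_)
          filter_upwards [hwM] with x hx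
          rw [← hr]
          refine ENNReal.ofReal_le_ofReal (Real.rpow_le_rpow
            (le_min (hw x) N₀.cast_nonneg) ?_ (by linarith))
          rw [← ENNReal.ofReal_le_ofReal_iff ENNReal.toReal_nonneg, hfE]
          exact le_min ((ENNReal.ofReal_le_ofReal (min_le_left _ _)).trans hx)
            (ENNReal.ofReal_le_ofReal ((min_le_right _ _).trans hN₀))
      _ = ENNReal.ofReal (∫ x in B, f x ^ (1 + ε)) :=
          (ofReal_integral_eq_lintegral_ofReal hint2
            (.of_forall fun x => Real.rpow_nonneg ENNReal.toReal_nonneg _)).symm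
      _ ≤ _ := ENNReal.ofReal_le_ofReal hfr
  have hlim : ∫⁻ x in B, ENNReal.ofReal (w x ^ r) ≤ ENNReal.ofReal (A * m ^ r * b) := by
    calc ∫⁻ x in B, ENNReal.ofReal (w x ^ r)
        ≤ ∫⁻ x in B, ⨆ N : ℕ, ENNReal.ofReal (min (w x) N ^ r) := by
          refine lintegral_mono fun x => ?_
          obtain ⟨N, hN⟩ := exists_nat_ge (w x)
          refine le_iSup_of_le N ?_
          rw [min_eq_left hN]
      _ = ⨆ N : ℕ, ∫⁻ x in B, ENNReal.ofReal (min (w x) N ^ r) := by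
          refine lintegral_iSup' (fun N => ?_) (.of_forall fun x => ?_)
          · exact ((hwm.min aemeasurable_const).pow_const r).restrict.ennreal_ofReal
          · intro N N' h
            refine ENNReal.ofReal_le_ofReal (Real.rpow_le_rpow (le_min (hw x) N.cast_nonneg)
              (min_le_min_left _ (Nat.cast_le.2 h)) (by linarith))
      _ ≤ _ := iSup_le htrunc
  refine ENNReal.div_le_of_le_mul (hlim.trans_eq ?_)
  rw [ENNReal.ofReal_mul (by positivity), ENNReal.ofReal_mul hA0, hbE,
    ENNReal.ofReal_rpow_of_pos hm0]
end
end

section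
/- Let w be a weight on ℝ and let δ > 1. Assume the Fujii–Wilson condition with constant δ: for every bounded interval I, ∫_I M(w·1_I) dx ≤ δ·w(I). Then for every bounded interval I and every exponent r with 1 ≤ r < δ/(δ−1), one has (1/|I|)∫_I M(w·1_I)ʳ dx ≤ δ^{1−r} · (r′−1)/(r′−δ) · ((1/|I|)∫_I M(w·1_I) dx)ʳ. -/
open MeasureTheory Set ENNReal

noncomputable section

/-- The non-centered Hardy–Littlewood maximal operator on `ℝ`, as a supremum of
averages over bounded open intervals containing the point. -/
def M1 (f : ℝ → ℝ) (x : ℝ) : ℝ≥0∞ :=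
  ⨆ (a : ℝ) (b : ℝ) (_ : a < b) (_ : x ∈ Set.Ioo a b),
    (∫⁻ y in Set.Ioo a b, ENNReal.ofReal |f y|) / volume (Set.Ioo a b)

theorem le_M1 (f : ℝ → ℝ) {c d x : ℝ} (hx : x ∈ Ioo c d) :
    (∫⁻ y in Ioo c d, ENNReal.ofReal |f y|) / volume (Ioo c d) ≤ M1 f x :=
  le_iSup_of_le c <| le_iSup_of_le d <| le_iSup_of_le (hx.1.trans hx.2) <|
    le_iSup_of_le hx le_rfl

theorem lt_M1_iff (f : ℝ → ℝ) (L : ℝ≥0∞) (x : ℝ) :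
    L < M1 f x ↔ ∃ c d, x ∈ Ioo c d ∧
      L < (∫⁻ y in Ioo c d, ENNReal.ofReal |f y|) / volume (Ioo c d) := by
  simp only [M1, lt_iSup_iff]
  constructor
  · rintro ⟨c, d, _, hx, h⟩
    exact ⟨c, d, hx, h⟩
  · rintro ⟨c, d, hx, h⟩
    exact ⟨c, d, hx.1.trans hx.2, hx, h⟩

theorem isOpen_lt_M1 (f : ℝ → ℝ) (L : ℝ≥0∞) : IsOpen {x | L < M1 f x} := by
  refine isOpen_iff_mem_nhds.2 fun x hx => ?_
  obtain ⟨c, d, hxc, h⟩ := (lt_M1_iff f L x).1 hx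
  filter_upwards [Ioo_mem_nhds hxc.1 hxc.2] with y hy
  exact (lt_M1_iff f L y).2 ⟨c, d, hy, h⟩

theorem measurable_M1 (f : ℝ → ℝ) : Measurable (M1 f) :=
  (lowerSemicontinuous_iff_isOpen_preimage.2 fun L => isOpen_lt_M1 f L).measurable

theorem lintegral_Ioo_le_of_M1_le (f : ℝ → ℝ) {L : ℝ≥0∞} (hL : L ≠ ∞) {c d x : ℝ}
    (hx : x ∈ Icc c d) (h : M1 f x ≤ L) :
    ∫⁻ y in Ioo c d, ENNReal.ofReal |f y| ≤ L * ENNReal.ofReal (d - c) := by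
  have key : ∀ ε : ℝ, 0 < ε →
      ∫⁻ y in Ioo c d, ENNReal.ofReal |f y| ≤ L * ENNReal.ofReal (d - c + 2 * ε) := by
    intro ε hε
    have hx' : x ∈ Ioo (c - ε) (d + ε) := ⟨by linarith [hx.1], by linarith [hx.2]⟩
    have h1 := (le_M1 f hx').trans h
    rw [Real.volume_Ioo, ENNReal.div_le_iff
      (by simpa using hx'.1.trans hx'.2) ENNReal.ofReal_ne_top] at h1
    calc _ ≤ ∫⁻ y in Ioo (c - ε) (d + ε), ENNReal.ofReal |f y| :=
          lintegral_mono_set (Ioo_subset_Ioo (by linarith) (by linarith))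
      _ ≤ _ := h1
      _ = _ := by ring_nf
  have hlim : Filter.Tendsto (fun ε : ℝ => L * ENNReal.ofReal (d - c + 2 * ε))
      (nhdsWithin 0 (Ioi 0)) (nhds (L * ENNReal.ofReal (d - c + 2 * 0))) := by
    refine ENNReal.Tendsto.const_mul ?_ (Or.inr hL)
    refine (ENNReal.tendsto_ofReal ?_).mono_left nhdsWithin_le_nhds
    exact Continuous.tendsto (by fun_prop) 0
  rw [mul_zero, add_zero] at hlim
  exact ge_of_tendsto hlim (by filter_upwards [self_mem_nhdsWithin] with ε hε using key ε hε)

theorem connectedComponentIn_eq_Ioo {S : Set ℝ} (hS : IsOpen S) {a b : ℝ} (hab : S ⊆ Ioo a b)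
    {x : ℝ} (hx : x ∈ S) :
    ∃ c d, a ≤ c ∧ c < d ∧ d ≤ b ∧ c ∉ S ∧ d ∉ S ∧ connectedComponentIn S x = Ioo c d := by
  set C := connectedComponentIn S x with hC
  have hCo : IsOpen C := hS.connectedComponentIn
  have hCS : C ⊆ S := connectedComponentIn_subset S x
  have hCp : IsPreconnected C := isPreconnected_connectedComponentIn
  have hxC : x ∈ C := mem_connectedComponentIn hx
  have hbb : BddBelow C := ⟨a, fun y hy => (hab (hCS hy)).1.le⟩
  have hba : BddAbove C := ⟨b, fun y hy => (hab (hCS hy)).2.le⟩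
  have hsub : Ioo (sInf C) (sSup C) ⊆ C :=
    IsConnected.Ioo_csInf_csSup_subset ⟨⟨x, hxC⟩, hCp⟩ hbb hba
  have hinf : ∀ y ∈ C, sInf C < y := fun y hy => by
    obtain ⟨l, u, hl, hs⟩ := mem_nhds_iff_exists_Ioo_subset.1 (hCo.mem_nhds hy)
    have := csInf_le hbb (hs ⟨(by linarith [hl.1] : l < (l + y) / 2), by linarith [hl.1, hl.2]⟩)
    linarith [hl.1]
  have hsup : ∀ y ∈ C, y < sSup C := fun y hy => by
    obtain ⟨l, u, hl, hs⟩ := mem_nhds_iff_exists_Ioo_subset.1 (hCo.mem_nhds hy)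
    have := le_csSup hba (hs ⟨by linarith [hl.1, hl.2], (by linarith [hl.2] : (y + u) / 2 < u)⟩)
    linarith [hl.2]
  have hEq : C = Ioo (sInf C) (sSup C) :=
    Subset.antisymm (fun y hy => ⟨hinf y hy, hsup y hy⟩) hsub
  have h1 := hinf x hxC
  have h2 := hsup x hxC
  refine ⟨sInf C, sSup C, le_csInf ⟨x, hxC⟩ fun y hy => (hab (hCS hy)).1.le, h1.trans h2,
    csSup_le ⟨x, hxC⟩ fun y hy => (hab (hCS hy)).2.le, fun hc => ?_, fun hd => ?_, hEq⟩
  · have hs : Ico (sInf C) (sSup C) ⊆ C := by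
      refine isPreconnected_Ico.subset_connectedComponentIn (x := x) ⟨h1.le, h2⟩ fun y hy => ?_
      rcases hy.1.eq_or_lt with h | h
      · exact h ▸ hc
      · exact hCS (hsub ⟨h, hy.2⟩)
    exact lt_irrefl _ (hinf _ (hs ⟨le_rfl, h1.trans h2⟩))
  · have hs : Ioc (sInf C) (sSup C) ⊆ C := by
      refine isPreconnected_Ioc.subset_connectedComponentIn (x := x) ⟨h1, h2.le⟩ fun y hy => ?_
      rcases hy.2.eq_or_lt with h | h
      · exact h ▸ hd
      · exact hCS (hsub ⟨hy.1, h⟩)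
    exact lt_irrefl _ (hsup _ (hs ⟨h1.trans h2, le_rfl⟩))

/-- On a component `C` of the part of a superlevel set inside an interval, the maximal function of
`w` localized to the interval agrees with that of `w` localized to `C`. -/
theorem M1_indicator_le_component (w : ℝ → ℝ) {a b x : ℝ} {L : ℝ≥0∞}
    (hx : x ∈ Ioo a b) (hLx : L < M1 ((Ioo a b).indicator w) x) :
    M1 ((Ioo a b).indicator w) x ≤
      M1 ((connectedComponentIn (Ioo a b ∩ {y | L < M1 ((Ioo a b).indicator w) y}) x).indicator w)
        x := by
  set f := (Ioo a b).indicator w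
  set C := connectedComponentIn (Ioo a b ∩ {y | L < M1 f y}) x
  have hCI : C ⊆ Ioo a b := (connectedComponentIn_subset _ _).trans inter_subset_left
  have key : ∀ c d, x ∈ Ioo c d → L < (∫⁻ y in Ioo c d, ENNReal.ofReal |f y|) / volume (Ioo c d) →
      (∫⁻ y in Ioo c d, ENNReal.ofReal |f y|) / volume (Ioo c d) ≤ M1 (C.indicator w) x := by
    intro c d hxc h
    refine le_trans (le_of_eq ?_) (le_M1 (C.indicator w) hxc)
    congr 1
    refine setLIntegral_congr_fun measurableSet_Ioo fun y hy => ?_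
    have hsub : Ioo c d ∩ Ioo a b ⊆ C := by
      have hp : IsPreconnected (Ioo c d ∩ Ioo a b) :=
        (ordConnected_Ioo.inter ordConnected_Ioo).isPreconnected
      exact hp.subset_connectedComponentIn ⟨hxc, hx⟩
        fun z hz => ⟨hz.2, (lt_M1_iff f L z).2 ⟨c, d, hz.1, h⟩⟩
    have : f y = C.indicator w y := by
      by_cases hyI : y ∈ Ioo a b
      · rw [indicator_of_mem (hsub ⟨hy, hyI⟩)]
        exact indicator_of_mem hyI w
      · rw [indicator_of_notMem (fun h => hyI (hCI h))]
        exact indicator_of_notMem hyI w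
    simp only [this]
  obtain ⟨c₀, d₀, hx₀, h₀⟩ := (lt_M1_iff f L x).1 hLx
  refine iSup_le fun c => iSup_le fun d => iSup_le fun _ => iSup_le fun hxc => ?_
  by_cases h : L < (∫⁻ y in Ioo c d, ENNReal.ofReal |f y|) / volume (Ioo c d)
  · exact key c d hxc h
  · exact (not_lt.1 h).trans (h₀.le.trans (key c₀ d₀ hx₀ h₀))

theorem setLIntegral_abs_indicator {w : ℝ → ℝ} (hw : ∀ x, 0 ≤ w x) {s t : Set ℝ}
    (hs : MeasurableSet s) (hst : s ⊆ t) :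
    ∫⁻ y in s, ENNReal.ofReal |t.indicator w y| = ∫⁻ y in s, ENNReal.ofReal (w y) :=
  setLIntegral_congr_fun hs fun y hy => by
    simp only [indicator_of_mem (hst hy), abs_of_nonneg (hw y)]

/-- The Fujii–Wilson condition propagates to superlevel sets of the localized maximal function. -/
theorem setLIntegral_lt_M1_le {w : ℝ → ℝ} (hw : ∀ x, 0 ≤ w x) {δ : ℝ}
    (hFW : ∀ a b : ℝ, a < b →
      (∫⁻ x in Ioo a b, M1 ((Ioo a b).indicator w) x) ≤
        ENNReal.ofReal δ * ∫⁻ x in Ioo a b, ENNReal.ofReal (w x))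
    {a b : ℝ} (hab : a < b) {L : ℝ≥0∞} (hL : L ≠ ∞)
    (hLI : ∫⁻ x in Ioo a b, ENNReal.ofReal (w x) ≤ L * volume (Ioo a b)) :
    ∫⁻ x in Ioo a b ∩ {x | L < M1 ((Ioo a b).indicator w) x}, M1 ((Ioo a b).indicator w) x ≤
      ENNReal.ofReal δ * L * volume (Ioo a b ∩ {x | L < M1 ((Ioo a b).indicator w) x}) := by
  set f := (Ioo a b).indicator w with hf
  set U := Ioo a b ∩ {x | L < M1 f x} with hU
  have hUo : IsOpen U := isOpen_Ioo.inter (isOpen_lt_M1 f L)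
  have hUI : U ⊆ Ioo a b := inter_subset_left
  set T : Set (Set ℝ) := image (connectedComponentIn U) U with hT
  have hTo : ∀ C ∈ T, IsOpen C := by
    rintro _ ⟨x, _, rfl⟩
    exact hUo.connectedComponentIn
  have hTd : T.PairwiseDisjoint id := by
    rintro _ ⟨x, _, rfl⟩ _ ⟨y, _, rfl⟩ hne
    refine Set.disjoint_left.2 fun z hzx hzy => hne ?_
    exact (connectedComponentIn_eq hzx).trans (connectedComponentIn_eq hzy).symm
  have hTc : T.Countable := hTd.countable_of_isOpen hTo <| by
    rintro _ ⟨x, hx, rfl⟩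
    exact ⟨x, mem_connectedComponentIn hx⟩
  have hUT : U = ⋃ C ∈ T, id C := by
    ext x
    simp only [mem_iUnion, id]
    constructor
    · exact fun hx => ⟨_, ⟨x, hx, rfl⟩, mem_connectedComponentIn hx⟩
    · rintro ⟨_, ⟨y, _, rfl⟩, hx⟩
      exact connectedComponentIn_subset _ _ hx
  have hcomp : ∀ C ∈ T, ∫⁻ x in C, M1 f x ≤ ENNReal.ofReal δ * L * volume C := by
    rintro _ ⟨x, hx, rfl⟩
    obtain ⟨c, d, hac, hcd, hdb, hc, hd, hC⟩ := connectedComponentIn_eq_Ioo hUo hUI hx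
    have hCU : Ioo c d ⊆ U := hC ▸ connectedComponentIn_subset U x
    have hle : ∀ y ∈ Ioo c d, M1 f y ≤ M1 ((Ioo c d).indicator w) y := by
      intro y hy
      have hyU := hCU hy
      have := M1_indicator_le_component w hyU.1 hyU.2
      rwa [← hf, ← hU, ← connectedComponentIn_eq (hC ▸ hy : y ∈ connectedComponentIn U x), hC]
        at this
    have havg : ∫⁻ y in Ioo c d, ENNReal.ofReal (w y) ≤ L * volume (Ioo c d) := by
      have hend : ∀ z ∈ Icc c d, z ∈ Ioo a b → z ∉ U →
          ∫⁻ y in Ioo c d, ENNReal.ofReal (w y) ≤ L * volume (Ioo c d) := by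
        intro z hz hzI hzU
        rw [← setLIntegral_abs_indicator hw measurableSet_Ioo (hCU.trans hUI), Real.volume_Ioo]
        exact lintegral_Ioo_le_of_M1_le f hL hz (not_lt.1 fun h => hzU ⟨hzI, h⟩)
      rcases hac.eq_or_lt with rfl | hac
      · rcases hdb.eq_or_lt with rfl | hdb
        · exact hLI
        · exact hend d ⟨hcd.le, le_rfl⟩ ⟨hcd, hdb⟩ hd
      · exact hend c ⟨le_rfl, hcd.le⟩ ⟨hac, hcd.trans_le hdb⟩ hc
    rw [hC]
    calc ∫⁻ y in Ioo c d, M1 f y ≤ ∫⁻ y in Ioo c d, M1 ((Ioo c d).indicator w) y :=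
          setLIntegral_mono' measurableSet_Ioo hle
      _ ≤ _ := hFW c d hcd
      _ ≤ ENNReal.ofReal δ * (L * volume (Ioo c d)) := by gcongr
      _ = _ := (mul_assoc _ _ _).symm
  have hTm : ∀ C ∈ T, MeasurableSet (id C) := fun C hC => (hTo C hC).measurableSet
  rw [hUT, lintegral_biUnion hTc hTm hTd, measure_biUnion hTc hTd hTm, ← ENNReal.tsum_mul_left]
  exact ENNReal.tsum_le_tsum fun C => hcomp C C.2

section Truncation

variable {α : Type*} [MeasurableSpace α]

theorem intervalIntegral_mul_add_rpow {p t u : ℝ} (ht : 0 < t) (hu : 0 ≤ u) :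
    ∫ s in (0 : ℝ)..u, p * (s + t) ^ (p - 1) = (u + t) ^ p - t ^ p := by
  have hpos : ∀ s ∈ uIcc 0 u, s + t ≠ 0 := fun s hs => by
    rw [uIcc_of_le hu] at hs
    linarith [hs.1]
  rw [intervalIntegral.integral_eq_sub_of_hasDerivAt (f := fun s => (s + t) ^ p)]
  · simp
  · intro s hs
    simpa using ((hasDerivAt_id s).add_const t).rpow_const (p := p) (Or.inl (hpos s hs))
  · refine ContinuousOn.intervalIntegrable fun s hs => ContinuousAt.continuousWithinAt ?_
    exact continuousAt_const.mul
      (ContinuousAt.rpow_const (by fun_prop) (Or.inl (hpos s hs)))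

theorem lintegral_rpow_sub_rpow_eq (μ : Measure α) {G : α → ℝ} (hG : Measurable G) {p t : ℝ}
    (hp : 0 ≤ p) (ht : 0 < t) (hGt : ∀ᵐ x ∂μ, t ≤ G x) :
    ∫⁻ x, ENNReal.ofReal (G x ^ p - t ^ p) ∂μ =
      ∫⁻ s in Ioi (0 : ℝ), μ {x | s < G x - t} * ENNReal.ofReal (p * (s + t) ^ (p - 1)) := by
  rw [← lintegral_comp_eq_lintegral_meas_lt_mul μ (f := fun x => G x - t)
    (g := fun s => p * (s + t) ^ (p - 1))]
  · refine lintegral_congr_ae ?_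
    filter_upwards [hGt] with x hx
    rw [intervalIntegral_mul_add_rpow ht (sub_nonneg.2 hx), sub_add_cancel]
  · filter_upwards [hGt] with x hx using sub_nonneg.2 hx
  · exact (hG.sub_const t).aemeasurable
  · intro u hu
    refine ContinuousOn.intervalIntegrable fun s hs => ContinuousAt.continuousWithinAt ?_
    rw [uIcc_of_le hu.le] at hs
    exact continuousAt_const.mul
      (ContinuousAt.rpow_const (by fun_prop) (Or.inl (by linarith [hs.1])))
  · filter_upwards [self_mem_ae_restrict measurableSet_Ioi] with s hs
    have : (0 : ℝ) < s := hs
    positivity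

theorem lintegral_truncation_rpow_sub_le (μ : Measure α) {F : α → ℝ≥0∞} (hF : Measurable F)
    {δ t r N : ℝ} (hδ : 0 ≤ δ) (ht : 0 < t) (hr : 1 < r) (htN : t ≤ N)
    (hFt : ∀ᵐ x ∂μ, ENNReal.ofReal t ≤ F x)
    (h : ∀ L, t ≤ L → ∫⁻ x in {x | ENNReal.ofReal L < F x}, F x ∂μ ≤
      ENNReal.ofReal δ * ENNReal.ofReal L * μ {x | ENNReal.ofReal L < F x}) :
    ∫⁻ x, ENNReal.ofReal ((min (F x) (ENNReal.ofReal N)).toReal ^ (r - 1) - t ^ (r - 1))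
        ∂(μ.withDensity F) ≤
      ENNReal.ofReal (δ * (r - 1) / r) *
        ∫⁻ x, ENNReal.ofReal ((min (F x) (ENNReal.ofReal N)).toReal ^ r - t ^ r) ∂μ := by
  set G : α → ℝ := fun x => (min (F x) (ENNReal.ofReal N)).toReal with hG
  have hGm : Measurable G := (hF.min measurable_const).ennreal_toReal
  have hGt : ∀ᵐ x ∂μ, t ≤ G x := by
    filter_upwards [hFt] with x hx
    refine (ENNReal.ofReal_le_iff_le_toReal ?_).1 (le_min hx (ENNReal.ofReal_le_ofReal htN))
    exact ne_top_of_le_ne_top ENNReal.ofReal_ne_top (min_le_right _ _)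
  rw [lintegral_rpow_sub_rpow_eq _ hGm (by linarith) ht
      ((withDensity_absolutelyContinuous μ F).ae_le hGt),
    lintegral_rpow_sub_rpow_eq _ hGm (by linarith) ht hGt,
    ← lintegral_const_mul' _ _ ENNReal.ofReal_ne_top]
  refine setLIntegral_mono' measurableSet_Ioi fun s hs => ?_
  have hs : 0 < s := hs
  have hst : 0 < s + t := by linarith
  have hset : {x | s < G x - t} = {x | ENNReal.ofReal (s + t) < F x ∧ s + t < N} := by
    ext x
    have hne : min (F x) (ENNReal.ofReal N) ≠ ∞ :=
      ne_top_of_le_ne_top ENNReal.ofReal_ne_top (min_le_right _ _)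
    simp only [mem_ofPred_eq, lt_sub_iff_add_lt]
    rw [hG, ← ENNReal.ofReal_lt_iff_lt_toReal hst.le hne, lt_min_iff,
      ENNReal.ofReal_lt_ofReal_iff_of_nonneg hst.le]
  by_cases hN : s + t < N
  · have hset' : {x | s < G x - t} = {x | ENNReal.ofReal (s + t) < F x} := by
      simp [hset, hN]
    have hm : MeasurableSet {x | ENNReal.ofReal (s + t) < F x} := hF measurableSet_Ioi
    rw [hset', withDensity_apply _ hm]
    calc _ ≤ (ENNReal.ofReal δ * ENNReal.ofReal (s + t) * μ {x | ENNReal.ofReal (s + t) < F x}) *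
          ENNReal.ofReal ((r - 1) * (s + t) ^ (r - 1 - 1)) := by
            gcongr
            exact h _ (by linarith)
      _ = μ {x | ENNReal.ofReal (s + t) < F x} * (ENNReal.ofReal δ * ENNReal.ofReal (s + t) *
            ENNReal.ofReal ((r - 1) * (s + t) ^ (r - 1 - 1))) := by ring
      _ = μ {x | ENNReal.ofReal (s + t) < F x} * (ENNReal.ofReal (δ * (r - 1) / r) *
            ENNReal.ofReal (r * (s + t) ^ (r - 1))) := by
          rw [← ENNReal.ofReal_mul hδ, ← ENNReal.ofReal_mul (by positivity),
            ← ENNReal.ofReal_mul (div_nonneg (mul_nonneg hδ (by linarith)) (by linarith))]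
          congr 2
          rw [Real.rpow_sub_one hst.ne' (r - 1)]
          field_simp
      _ = _ := by ring
  · have : {x | s < G x - t} = ∅ := by
      simp [hset, hN]
    simp [this]

theorem mul_rpow_sub_one_mul_le {δ t r y : ℝ} (hδ : 0 < δ) (ht : 0 < t) (hr : 1 < r)
    (hy : 0 ≤ y) :
    r * (t ^ (r - 1) * y) ≤ δ * (r - 1) * t ^ r + δ ^ (1 - r) * y ^ r := by
  have hr0 : 0 < r := by linarith
  have hs : 0 < δ * t := mul_pos hδ ht
  have h := Real.geom_mean_le_arith_mean2_weighted (w₁ := (r - 1) / r) (w₂ := 1 / r)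
    (p₁ := (δ * t) ^ r) (p₂ := y ^ r) (div_nonneg (by linarith) hr0.le) (by positivity)
    (by positivity) (by positivity) (by field_simp; ring)
  rw [← Real.rpow_mul hs.le, ← Real.rpow_mul hy, mul_div_cancel₀ _ hr0.ne',
    mul_div_cancel₀ _ hr0.ne', Real.rpow_one, Real.mul_rpow hδ.le ht.le,
    Real.mul_rpow hδ.le ht.le] at h
  have h2 : δ ^ (1 - r) * δ ^ (r - 1) = 1 := by
    rw [← Real.rpow_add hδ]; simp
  have h3 : δ ^ (1 - r) * δ ^ r = δ := by
    rw [← Real.rpow_add hδ]; simp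
  have h4 := mul_le_mul_of_nonneg_left h (by positivity : 0 ≤ r * δ ^ (1 - r))
  calc r * (t ^ (r - 1) * y) = r * (δ ^ (1 - r) * δ ^ (r - 1)) * (t ^ (r - 1) * y) := by
        rw [h2]; ring
    _ = r * δ ^ (1 - r) * (δ ^ (r - 1) * t ^ (r - 1) * y) := by ring
    _ ≤ _ := h4
    _ = (δ ^ (1 - r) * δ ^ r) * (r - 1) * t ^ r + δ ^ (1 - r) * y ^ r := by
        field_simp
    _ = _ := by rw [h3]

theorem lintegral_truncation_rpow_le (μ : Measure α) [IsFiniteMeasure μ] {F : α → ℝ≥0∞}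
    (hF : Measurable F) (hFi : ∫⁻ x, F x ∂μ ≠ ∞) {δ t r N : ℝ} (hδ : 1 < δ) (ht : 0 < t)
    (hr : 1 < r) (hr2 : 0 < δ - (δ - 1) * r) (htN : t ≤ N)
    (hFt : ∀ᵐ x ∂μ, ENNReal.ofReal t ≤ F x)
    (h : ∀ L, t ≤ L → ∫⁻ x in {x | ENNReal.ofReal L < F x}, F x ∂μ ≤
      ENNReal.ofReal δ * ENNReal.ofReal L * μ {x | ENNReal.ofReal L < F x}) :
    ∫⁻ x, min (F x) (ENNReal.ofReal N) ^ r ∂μ ≤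
      ENNReal.ofReal (δ ^ (1 - r) * (1 / (δ - (δ - 1) * r))) *
        ((∫⁻ x, F x ∂μ) / μ univ) ^ r * μ univ := by
  rcases eq_or_ne (μ univ) 0 with hμ | hμ
  · simp [Measure.measure_univ_eq_zero.1 hμ]
  have hr0 : 0 < r := by linarith
  have hN : 0 < N := ht.trans_le htN
  have key := lintegral_truncation_rpow_sub_le μ hF (by linarith) ht hr htN hFt h
  set G : α → ℝ := fun x => (min (F x) (ENNReal.ofReal N)).toReal with hG
  have hne : ∀ x, min (F x) (ENNReal.ofReal N) ≠ ∞ := fun x =>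
    ne_top_of_le_ne_top ENNReal.ofReal_ne_top (min_le_right _ _)
  have hGF : ∀ x, ENNReal.ofReal (G x) = min (F x) (ENNReal.ofReal N) := fun x =>
    ENNReal.ofReal_toReal (hne x)
  have hG0 : ∀ x, 0 ≤ G x := fun x => ENNReal.toReal_nonneg
  have hGN : ∀ x, G x ≤ N := fun x =>
    ENNReal.toReal_le_of_le_ofReal hN.le (min_le_right _ _)
  have hGt : ∀ᵐ x ∂μ, t ≤ G x := by
    filter_upwards [hFt] with x hx
    exact (ENNReal.ofReal_le_iff_le_toReal (hne x)).1
      (le_min hx (ENNReal.ofReal_le_ofReal htN))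
  have hsplit : ∀ p : ℝ, 0 ≤ p → ∀ m : Measure α, (∀ᵐ x ∂m, t ≤ G x) →
      ∫⁻ x, ENNReal.ofReal (G x ^ p) ∂m =
        ∫⁻ x, ENNReal.ofReal (G x ^ p - t ^ p) ∂m + ENNReal.ofReal (t ^ p) * m univ := by
    intro p hp m hm
    rw [← lintegral_const, ← lintegral_add_right _ measurable_const]
    refine lintegral_congr_ae ?_
    filter_upwards [hm] with x hx
    rw [← ENNReal.ofReal_add (sub_nonneg.2 (Real.rpow_le_rpow ht.le hx hp)) (by positivity),
      sub_add_cancel]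
  have hXeq : ∫⁻ x, min (F x) (ENNReal.ofReal N) ^ r ∂μ =
      ∫⁻ x, ENNReal.ofReal (G x ^ r) ∂μ := by
    refine lintegral_congr fun x => ?_
    rw [← hGF, ENNReal.ofReal_rpow_of_nonneg (hG0 x) hr0.le]
  have hX1 := hsplit r hr0.le μ hGt
  have hX2 := hsplit (r - 1) (by linarith) (μ.withDensity F)
    ((withDensity_absolutelyContinuous μ F).ae_le hGt)
  have hX3 : ∫⁻ x, ENNReal.ofReal (G x ^ r) ∂μ ≤
      ∫⁻ x, ENNReal.ofReal (G x ^ (r - 1)) ∂(μ.withDensity F) := by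
    have hGm : Measurable G := (hF.min measurable_const).ennreal_toReal
    rw [lintegral_withDensity_eq_lintegral_mul _ hF (hGm.pow_const _).ennreal_ofReal]
    refine lintegral_mono_ae ?_
    filter_upwards [hGt] with x hx
    have hGx : G x ≠ 0 := (ht.trans_le hx).ne'
    have : G x ^ r = G x * G x ^ (r - 1) := by
      rw [Real.rpow_sub_one hGx]; field_simp
    rw [this, ENNReal.ofReal_mul (hG0 x), hGF, Pi.mul_apply]
    gcongr
    exact min_le_left _ _
  rw [withDensity_apply _ MeasurableSet.univ, Measure.restrict_univ] at hX2
  rw [hXeq]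
  have hXfin : ∫⁻ x, ENNReal.ofReal (G x ^ r) ∂μ ≠ ∞ := by
    refine ne_top_of_le_ne_top (b := ENNReal.ofReal (N ^ r) * μ univ) (by finiteness) ?_
    rw [← lintegral_const]
    exact lintegral_mono fun x =>
      ENNReal.ofReal_le_ofReal (Real.rpow_le_rpow (hG0 x) (hGN x) hr0.le)
  have hle := hX3.trans (hX2.le.trans (add_le_add_left key _))
  have hPfin : ∫⁻ x, ENNReal.ofReal (G x ^ r - t ^ r) ∂μ ≠ ∞ :=
    ne_top_of_le_ne_top hXfin (hX1 ▸ le_self_add)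
  generalize ∫⁻ x, ENNReal.ofReal (G x ^ r) ∂μ = X at *
  generalize ∫⁻ x, ENNReal.ofReal (G x ^ r - t ^ r) ∂μ = P at *
  generalize ∫⁻ x, F x ∂μ = A at *
  have hm : μ univ ≠ ∞ := measure_ne_top μ univ
  generalize μ univ = m at *
  lift X to NNReal using hXfin
  lift P to NNReal using hPfin
  lift A to NNReal using hFi
  lift m to NNReal using hm
  have hm0 : (0 : ℝ) < m := by
    have : m ≠ 0 := by exact_mod_cast hμ
    positivity
  have hκ : 0 ≤ δ * (r - 1) / r := div_nonneg (mul_nonneg (by linarith) (by linarith)) hr0.le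
  have e1 : (X : ℝ) = P + t ^ r * m := by
    have := congrArg ENNReal.toReal hX1
    rwa [ENNReal.toReal_add (by finiteness) (by finiteness), ENNReal.toReal_mul,
      ENNReal.toReal_ofReal (by positivity)] at this
  have e2 : (X : ℝ) ≤ δ * (r - 1) / r * P + t ^ (r - 1) * A := by
    have := ENNReal.toReal_mono (by finiteness) hle
    rwa [ENNReal.toReal_add (by finiteness) (by finiteness), ENNReal.toReal_mul,
      ENNReal.toReal_mul, ENNReal.toReal_ofReal hκ, ENNReal.toReal_ofReal (by positivity)] at this
  have e3 := mul_rpow_sub_one_mul_le (δ := δ) (y := A / m) (by linarith) ht hr (by positivity)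
  have e4 : (δ - (δ - 1) * r) * X ≤ δ ^ (1 - r) * (A / m : ℝ) ^ r * m := by
    have e5 : r * (t ^ (r - 1) * A) ≤
        δ * (r - 1) * t ^ r * m + δ ^ (1 - r) * (A / m : ℝ) ^ r * m := by
      calc r * (t ^ (r - 1) * A) = r * (t ^ (r - 1) * (A / m : ℝ)) * m := by field_simp
        _ ≤ _ := mul_le_mul_of_nonneg_right e3 hm0.le
        _ = _ := by ring
    have e6 : r * X ≤ δ * (r - 1) * P + r * (t ^ (r - 1) * A) := by
      calc r * X ≤ r * (δ * (r - 1) / r * P + t ^ (r - 1) * A) := by gcongr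
        _ = _ := by field_simp
    have e7 : (P : ℝ) = X - t ^ r * m := by linarith
    rw [e7] at e6
    nlinarith [e5, e6]
  have e8 : (X : ℝ) ≤ δ ^ (1 - r) * (1 / (δ - (δ - 1) * r)) * (A / m : ℝ) ^ r * m := by
    calc (X : ℝ) ≤ (δ ^ (1 - r) * (A / m : ℝ) ^ r * m) / (δ - (δ - 1) * r) := by
          rw [le_div_iff₀ hr2]; linarith
      _ = _ := by ring
  have hC : 0 ≤ δ ^ (1 - r) * (1 / (δ - (δ - 1) * r)) :=
    mul_nonneg (Real.rpow_nonneg (by linarith) _) (by positivity)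
  have e9 := ENNReal.ofReal_le_ofReal e8
  rw [ENNReal.ofReal_mul (by positivity), ENNReal.ofReal_mul hC,
    ← ENNReal.ofReal_rpow_of_nonneg (by positivity) hr0.le, ENNReal.ofReal_div_of_pos hm0,
    ENNReal.ofReal_coe_nnreal, ENNReal.ofReal_coe_nnreal, ENNReal.ofReal_coe_nnreal] at e9
  exact e9

theorem lintegral_rpow_le_of_superlevel (μ : Measure α) [IsFiniteMeasure μ] {F : α → ℝ≥0∞}
    (hF : Measurable F) (hFi : ∫⁻ x, F x ∂μ ≠ ∞) {δ t r : ℝ} (hδ : 1 < δ) (ht : 0 < t)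
    (hr : 1 < r) (hr2 : 0 < δ - (δ - 1) * r)
    (hFt : ∀ᵐ x ∂μ, ENNReal.ofReal t ≤ F x)
    (h : ∀ L, t ≤ L → ∫⁻ x in {x | ENNReal.ofReal L < F x}, F x ∂μ ≤
      ENNReal.ofReal δ * ENNReal.ofReal L * μ {x | ENNReal.ofReal L < F x}) :
    ∫⁻ x, F x ^ r ∂μ ≤
      ENNReal.ofReal (δ ^ (1 - r) * (1 / (δ - (δ - 1) * r))) *
        ((∫⁻ x, F x ∂μ) / μ univ) ^ r * μ univ := by
  have hlim : Filter.Tendsto (fun n : ℕ => ∫⁻ x, min (F x) (ENNReal.ofReal n) ^ r ∂μ)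
      Filter.atTop (nhds (∫⁻ x, F x ^ r ∂μ)) := by
    refine lintegral_tendsto_of_tendsto_of_monotone
      (fun n => ((hF.min measurable_const).pow_const r).aemeasurable) ?_ ?_
    · refine Filter.Eventually.of_forall fun x n k hnk => ?_
      dsimp only
      gcongr
    · refine Filter.Eventually.of_forall fun x => ?_
      refine (ENNReal.continuous_rpow_const.tendsto _).comp ?_
      simp only [ENNReal.ofReal_natCast]
      have := (tendsto_const_nhds (x := F x)).min ENNReal.tendsto_nat_nhds_top
      rwa [min_eq_left le_top] at this
  refine le_of_tendsto hlim ?_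
  filter_upwards [Filter.eventually_ge_atTop ⌈t⌉₊] with n hn
  exact lintegral_truncation_rpow_le μ hF hFi hδ ht hr hr2 (Nat.ceil_le.1 hn) hFt h

end Truncation

/-- Sharp reverse Hölder inequality for `M(w·1_I)` for an `A∞` weight on `ℝ` with
Fujii–Wilson constant at most `δ`.  The constant `δ^{1-r} (r'-1)/(r'-δ)` is written
in the equivalent form `δ^{1-r} / (δ - (δ-1) r)`, valid also at `r = 1`. -/
theorem stmt1 (w : ℝ → ℝ) (hw : ∀ x, 0 ≤ w x) (hloc : LocallyIntegrable w volume)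
    (δ : ℝ) (hδ : 1 < δ)
    (hFW : ∀ a b : ℝ, a < b →
      (∫⁻ x in Set.Ioo a b, M1 ((Set.Ioo a b).indicator w) x) ≤
        ENNReal.ofReal δ * ∫⁻ x in Set.Ioo a b, ENNReal.ofReal (w x))
    (a b : ℝ) (hab : a < b) (r : ℝ) (hr1 : 1 ≤ r) (hr2 : r < δ / (δ - 1)) :
    (∫⁻ x in Set.Ioo a b, (M1 ((Set.Ioo a b).indicator w) x) ^ r) / volume (Set.Ioo a b) ≤
      ENNReal.ofReal (δ ^ (1 - r) * (1 / (δ - (δ - 1) * r))) *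
        ((∫⁻ x in Set.Ioo a b, M1 ((Set.Ioo a b).indicator w) x) / volume (Set.Ioo a b)) ^ r := by
  have hr0 : 0 < r := by linarith
  have hvol : volume (Ioo a b) = ENNReal.ofReal (b - a) := Real.volume_Ioo
  have hv0 : volume (Ioo a b) ≠ 0 := by simpa [hvol] using hab
  have hvt : volume (Ioo a b) ≠ ∞ := by simp [hvol]
  rcases hr1.eq_or_lt with rfl | hr
  · simp
  have hr2' : 0 < δ - (δ - 1) * r := by
    rw [lt_div_iff₀ (by linarith)] at hr2
    linarith
  set F := M1 ((Ioo a b).indicator w) with hFdef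
  have hF : Measurable F := measurable_M1 _
  set W := ∫⁻ x in Ioo a b, ENNReal.ofReal (w x) with hW
  have hWt : W ≠ ∞ := by
    have hi : IntegrableOn w (Ioo a b) :=
      (hloc.integrableOn_isCompact isCompact_Icc).mono_set Ioo_subset_Icc_self
    exact ((hasFiniteIntegral_iff_ofReal (Filter.Eventually.of_forall hw)).1 hi.2).ne
  have hFi : ∫⁻ x in Ioo a b, F x ≠ ∞ :=
    ne_top_of_le_ne_top (ENNReal.mul_ne_top ENNReal.ofReal_ne_top hWt) (hFW a b hab)
  rcases eq_or_ne W 0 with hW0 | hW0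
  · have h0 : ∫⁻ x in Ioo a b, F x = 0 := by
      simpa [← hW, hW0] using hFW a b hab
    have h1 : ∫⁻ x in Ioo a b, F x ^ r = 0 := by
      rw [lintegral_eq_zero_iff hF] at h0
      rw [lintegral_eq_zero_iff (hF.pow_const r)]
      filter_upwards [h0] with x hx
      simp [hx, hr0]
    simp [h1]
  set t := (W / volume (Ioo a b)).toReal with ht
  have hWv : W / volume (Ioo a b) ≠ ∞ := ENNReal.div_ne_top hWt hv0
  have htW : ENNReal.ofReal t = W / volume (Ioo a b) := ENNReal.ofReal_toReal hWv
  have ht0 : 0 < t := ENNReal.toReal_pos (ENNReal.div_ne_zero.2 ⟨hW0, hvt⟩) hWv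
  have hFt : ∀ᵐ x ∂volume.restrict (Ioo a b), ENNReal.ofReal t ≤ F x := by
    filter_upwards [self_mem_ae_restrict measurableSet_Ioo] with x hx
    rw [htW, hW, ← setLIntegral_abs_indicator hw measurableSet_Ioo subset_rfl]
    exact le_M1 _ hx
  have main := lintegral_rpow_le_of_superlevel (volume.restrict (Ioo a b)) hF hFi hδ ht0 hr hr2'
    hFt fun L hL => by
      have hm : MeasurableSet {x | ENNReal.ofReal L < F x} := hF measurableSet_Ioi
      rw [Measure.restrict_restrict hm, Measure.restrict_apply hm, inter_comm]
      refine setLIntegral_lt_M1_le hw hFW hab ENNReal.ofReal_ne_top ?_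
      rw [← ENNReal.div_le_iff hv0 hvt, ← htW]
      exact ENNReal.ofReal_le_ofReal hL
  rw [Measure.restrict_apply_univ] at main
  exact (ENNReal.div_le_iff hv0 hvt).2 main
end
end

section
/- Let w be a weight on ℝ and let δ > 1. Assume w is an A₁ weight with constant at most δ, i.e., Mw(x) ≤ δ·w(x) for almost every x ∈ ℝ. Set r_w = δ/(δ−1). Then for every bounded interval I of positive length and every λ > 0, λ · (|{x ∈ I : w(x) > λ}|/|I|)^{1/r_w} ≤ (1/|I|)∫_I w dx; that is, ‖w‖_{L^{r_w,∞}(I, dx/|I|)} ≤ (1/|I|)∫_I w dx. -/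
open MeasureTheory Set ENNReal

noncomputable section

/-- A bound `∫ f ≤ K |·|` on every connected component of an open set of reals gives the same bound
on the whole set. -/
theorem setLIntegral_le_of_connectedComponentIn {O : Set ℝ} (hO : IsOpen O) (f : ℝ → ℝ≥0∞)
    (K : ℝ≥0∞)
    (h : ∀ x ∈ O, ∫⁻ y in connectedComponentIn O x, f y ≤ K * volume (connectedComponentIn O x)) :
    ∫⁻ y in O, f y ≤ K * volume O := by
  set S : Set (Set ℝ) := connectedComponentIn O '' O
  have hopen : ∀ C ∈ S, IsOpen C := by
    rintro _ ⟨x, -, rfl⟩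
    exact hO.connectedComponentIn
  have hne : ∀ C ∈ S, C.Nonempty := by
    rintro _ ⟨x, hx, rfl⟩
    exact connectedComponentIn_nonempty_iff.2 hx
  have hdisj : S.PairwiseDisjoint id := by
    rintro _ ⟨x, -, rfl⟩ _ ⟨y, -, rfl⟩ hxy
    refine Set.disjoint_left.2 fun z hzx hzy => hxy ?_
    exact (connectedComponentIn_eq hzx).trans (connectedComponentIn_eq hzy).symm
  have hcount : S.Countable := hdisj.countable_of_isOpen hopen hne
  have hmeas : ∀ C ∈ S, MeasurableSet (id C) := fun C hC => (hopen C hC).measurableSet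
  have hunion : ⋃ C ∈ S, id C = O := by
    refine Set.Subset.antisymm (Set.iUnion₂_subset ?_) fun x hx => ?_
    · rintro _ ⟨x, -, rfl⟩
      exact connectedComponentIn_subset O x
    · exact Set.mem_biUnion (Set.mem_image_of_mem _ hx) (mem_connectedComponentIn hx)
  rw [← hunion, lintegral_biUnion hcount hmeas hdisj, measure_biUnion hcount hdisj hmeas,
    ← ENNReal.tsum_mul_left]
  refine ENNReal.tsum_le_tsum ?_
  rintro ⟨_, x, hx, rfl⟩
  exact h x hx

/-- The components of a bounded open set of reals are open intervals with endpoints outside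
the set. -/
theorem exists_connectedComponentIn_eq_Ioo {O : Set ℝ} (hO : IsOpen O)
    (hb : BddBelow O) (ha : BddAbove O) {x : ℝ} (hx : x ∈ O) :
    ∃ c d, x ∈ Set.Ioo c d ∧ connectedComponentIn O x = Set.Ioo c d ∧ c ∉ O ∧ d ∉ O := by
  set C := connectedComponentIn O x with hC
  have hCO : C ⊆ O := connectedComponentIn_subset O x
  have hxC : x ∈ C := mem_connectedComponentIn hx
  have hCopen : IsOpen C := hO.connectedComponentIn
  have hbC := hb.mono hCO
  have haC := ha.mono hCO
  have hd : sSup C ∉ C := fun hmem => by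
    obtain ⟨u, hu, hsub⟩ := exists_Ico_subset_of_mem_nhds (hCopen.mem_nhds hmem) ⟨_, lt_add_one _⟩
    obtain ⟨v, hv⟩ := exists_between hu
    exact (le_csSup haC (hsub ⟨hv.1.le, hv.2⟩)).not_gt hv.1
  have hc : sInf C ∉ C := fun hmem => by
    obtain ⟨u, hu, hsub⟩ := exists_Ioc_subset_of_mem_nhds (hCopen.mem_nhds hmem) ⟨_, sub_one_lt _⟩
    obtain ⟨v, hv⟩ := exists_between hu
    exact (csInf_le hbC (hsub ⟨hv.1, hv.2.le⟩)).not_gt hv.2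
  have hlt : ∀ y ∈ C, y ∈ Set.Ioo (sInf C) (sSup C) := fun y hy =>
    ⟨(csInf_le hbC hy).lt_of_ne fun h => hc (h ▸ hy),
      (le_csSup haC hy).lt_of_ne fun h => hd (h ▸ hy)⟩
  have heq : C = Set.Ioo (sInf C) (sSup C) :=
    Set.Subset.antisymm hlt
      (IsConnected.Ioo_csInf_csSup_subset ⟨⟨x, hxC⟩, isPreconnected_connectedComponentIn⟩ hbC haC)
  have hxI := hlt x hxC
  refine ⟨sInf C, sSup C, hxI, heq, fun hcO => hc ?_, fun hdO => hd ?_⟩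
  · have hsub : Set.Ico (sInf C) (sSup C) ⊆ O := fun y hy => by
      rcases hy.1.eq_or_lt with h | h
      · exact h ▸ hcO
      · exact hCO (heq ▸ ⟨h, hy.2⟩)
    exact isPreconnected_Ico.subset_connectedComponentIn ⟨hxI.1.le, hxI.2⟩ hsub
      ⟨le_rfl, hxI.1.trans hxI.2⟩
  · have hsub : Set.Ioc (sInf C) (sSup C) ⊆ O := fun y hy => by
      rcases hy.2.eq_or_lt with h | h
      · exact h ▸ hdO
      · exact hCO (heq ▸ ⟨hy.1, h⟩)
    exact isPreconnected_Ioc.subset_connectedComponentIn ⟨hxI.1, hxI.2.le⟩ hsub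
      ⟨hxI.1.trans hxI.2, le_rfl⟩

/-- If averages of `f` over open intervals containing an endpoint of `(c, d)` are at most `K`, then
so is the average over `(c, d)`. -/
theorem setLIntegral_Ioo_le_of_endpoint {f : ℝ → ℝ≥0∞} {K : ℝ≥0∞} (hK : K ≠ ∞) {c d p : ℝ}
    (hcd : c < d) (hp : p = c ∨ p = d)
    (h : ∀ u v, u < p → p < v → ∫⁻ y in Set.Ioo u v, f y ≤ K * volume (Set.Ioo u v)) :
    ∫⁻ y in Set.Ioo c d, f y ≤ K * volume (Set.Ioo c d) := by
  have hlim : Filter.Tendsto (fun η : ℝ => K * ENNReal.ofReal (d - c + η))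
      (nhdsWithin 0 (Set.Ioi 0)) (nhds (K * volume (Set.Ioo c d))) := by
    rw [Real.volume_Ioo]
    refine ENNReal.Tendsto.const_mul ?_ (Or.inr hK)
    refine ENNReal.tendsto_ofReal (Filter.Tendsto.mono_left ?_ nhdsWithin_le_nhds)
    exact Continuous.tendsto' (by fun_prop) _ _ (by simp)
  refine ge_of_tendsto hlim ?_
  filter_upwards [self_mem_nhdsWithin] with η (hη : 0 < η)
  rcases hp with rfl | rfl
  · calc ∫⁻ y in Set.Ioo p d, f y ≤ ∫⁻ y in Set.Ioo (p - η) d, f y :=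
          lintegral_mono_set (Set.Ioo_subset_Ioo_left (by linarith))
      _ ≤ K * volume (Set.Ioo (p - η) d) := h _ _ (by linarith) hcd
      _ = _ := by rw [Real.volume_Ioo]; congr 2; ring
  · calc ∫⁻ y in Set.Ioo c p, f y ≤ ∫⁻ y in Set.Ioo c (p + η), f y :=
          lintegral_mono_set (Set.Ioo_subset_Ioo_right (by linarith))
      _ ≤ K * volume (Set.Ioo c (p + η)) := h _ _ hcd (by linarith)
      _ = _ := by rw [Real.volume_Ioo]; congr 2; ring

/-- A rising sun type estimate: if the averages of `f` over all open intervals meeting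
`(a, b) \ O` are at most `K`, and `O` is a proper open subset of `(a, b)`, then the average of `f`
over `O` is at most `K`. -/
theorem setLIntegral_le_of_isOpen_ssubset_Ioo {f : ℝ → ℝ≥0∞} {K : ℝ≥0∞} (hK : K ≠ ∞) {a b : ℝ}
    {O : Set ℝ} (hO : IsOpen O) (hOI : O ⊂ Set.Ioo a b)
    (h : ∀ p ∈ Set.Ioo a b \ O, ∀ u v, u < p → p < v →
      ∫⁻ y in Set.Ioo u v, f y ≤ K * volume (Set.Ioo u v)) :
    ∫⁻ y in O, f y ≤ K * volume O := by
  refine setLIntegral_le_of_connectedComponentIn hO f K fun x hx => ?_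
  obtain ⟨c, d, hxcd, heq, hc, hd⟩ := exists_connectedComponentIn_eq_Ioo hO
    (bddBelow_Ioo.mono hOI.subset) (bddAbove_Ioo.mono hOI.subset) hx
  have hsub : Set.Ioo c d ⊆ O := heq ▸ connectedComponentIn_subset O x
  have hcd : c < d := hxcd.1.trans hxcd.2
  obtain ⟨hac, hdb⟩ := (Set.Ioo_subset_Ioo_iff hcd).1 (hsub.trans hOI.subset)
  rw [heq]
  rcases hac.eq_or_lt with rfl | hac
  · rcases hdb.eq_or_lt with rfl | hdb
    · exact absurd hsub hOI.2
    · exact setLIntegral_Ioo_le_of_endpoint hK hcd (Or.inr rfl)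
        (h d ⟨⟨hcd, hdb⟩, hd⟩)
  · exact setLIntegral_Ioo_le_of_endpoint hK hcd (Or.inl rfl)
      (h c ⟨⟨hac, hcd.trans_le hdb⟩, hc⟩)

/-- The average of an `A₁` weight over a superlevel set `{w > s}` in an interval is at most `δ s`,
provided that this set does not have full measure. -/
theorem setLIntegral_superlevel_le {w : ℝ → ℝ} {δ : ℝ} (hδ : 0 ≤ δ) (hw : ∀ x, 0 ≤ w x)
    (hA1 : ∀ᵐ x : ℝ ∂volume, M1 w x ≤ ENNReal.ofReal (δ * w x)) {a b s : ℝ}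
    (hs : volume {x ∈ Set.Ioo a b | s < w x} < volume (Set.Ioo a b)) :
    ∫⁻ x in {x ∈ Set.Ioo a b | s < w x}, ENNReal.ofReal (w x) ≤
      ENNReal.ofReal (δ * s) * volume {x ∈ Set.Ioo a b | s < w x} := by
  set E := {x ∈ Set.Ioo a b | s < w x} with hE
  set N := {x : ℝ | ¬ M1 w x ≤ ENNReal.ofReal (δ * w x)} with hN
  have hN0 : volume N = 0 := hA1
  have hEN : volume (E ∪ N) = volume E :=
    le_antisymm ((measure_union_le _ _).trans (by simp [hN0])) (measure_mono Set.subset_union_left)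
  have hgood : ∀ p ∈ Set.Ioo a b, p ∉ E ∪ N → ∀ u v, u < p → p < v →
      ∫⁻ y in Set.Ioo u v, ENNReal.ofReal (w y) ≤
        ENNReal.ofReal (δ * s) * volume (Set.Ioo u v) := by
    intro p hpI hp u v hup hpv
    simp only [hE, hN, Set.mem_union, Set.mem_ofPred_eq, not_or, not_and, not_not, not_lt] at hp
    have hM : (∫⁻ y in Set.Ioo u v, ENNReal.ofReal |w y|) / volume (Set.Ioo u v) ≤ M1 w p :=
      le_iSup_of_le u <| le_iSup_of_le v <| le_iSup_of_le (hup.trans hpv) <|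
        le_iSup_of_le ⟨hup, hpv⟩ le_rfl
    have hle := hM.trans (hp.2.trans
      (ENNReal.ofReal_le_ofReal (mul_le_mul_of_nonneg_left (hp.1 hpI) hδ)))
    simp only [abs_of_nonneg (hw _)] at hle
    refine (ENNReal.div_le_iff ?_ ?_).1 hle
    · simpa using hup.trans hpv
    · simp
  have hlim : Filter.Tendsto (fun r => ENNReal.ofReal (δ * s) * r)
      (nhdsWithin (volume E) (Set.Ioi (volume E))) (nhds (ENNReal.ofReal (δ * s) * volume E)) :=
    (ENNReal.Tendsto.const_mul Filter.tendsto_id (Or.inr ENNReal.ofReal_ne_top)).mono_left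
      nhdsWithin_le_nhds
  have : (nhdsWithin (volume E) (Set.Ioi (volume E))).NeBot := nhdsGT_neBot_of_exists_gt ⟨_, hs⟩
  refine ge_of_tendsto hlim ?_
  filter_upwards [Ioo_mem_nhdsGT hs] with r hr
  obtain ⟨U, hsub, hUo, hUr⟩ := (E ∪ N).exists_isOpen_lt_of_lt r (hEN.trans_lt hr.1)
  have hOr : volume (Set.Ioo a b ∩ U) < r := (measure_mono Set.inter_subset_right).trans_lt hUr
  calc ∫⁻ x in E, ENNReal.ofReal (w x) ≤ ∫⁻ x in Set.Ioo a b ∩ U, ENNReal.ofReal (w x) :=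
        lintegral_mono_set fun x hx => ⟨hx.1, hsub (Or.inl hx)⟩
    _ ≤ ENNReal.ofReal (δ * s) * volume (Set.Ioo a b ∩ U) := by
        refine setLIntegral_le_of_isOpen_ssubset_Ioo ENNReal.ofReal_ne_top (isOpen_Ioo.inter hUo)
          ⟨Set.inter_subset_left, fun hI => ?_⟩ fun p hp =>
            hgood p hp.1 fun hpE => hp.2 ⟨hp.1, hsub hpE⟩
        exact ((measure_mono hI).trans_lt (hOr.trans hr.2)).false
    _ ≤ ENNReal.ofReal (δ * s) * r := by gcongr

section Truncation

variable {α : Type*} [MeasurableSpace α] {ν : Measure α} {w : α → ℝ}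

theorem nullMeasurableSet_superlevel (hw : Integrable w ν) (s : ℝ) :
    NullMeasurableSet {x | s < w x} ν :=
  nullMeasurableSet_lt aemeasurable_const hw.aemeasurable

theorem integral_max_sub_zero_eq [IsFiniteMeasure ν] (hw : Integrable w ν) (s : ℝ) :
    ∫ x, max (w x - s) 0 ∂ν = ∫ x in {x | s < w x}, w x ∂ν - s * ν.real {x | s < w x} := by
  have hind : (fun x => max (w x - s) 0) = {x | s < w x}.indicator fun x => w x - s := by
    ext x
    by_cases hx : s < w x
    · simp [hx, hx.le]
    · simp [hx, not_lt.1 hx]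
  rw [hind, integral_indicator₀ (nullMeasurableSet_superlevel hw s),
    integral_sub hw.integrableOn (integrable_const _)]
  simp [mul_comm]

theorem integral_max_sub_zero_add_le [IsFiniteMeasure ν] (hw : Integrable w ν) {s t : ℝ}
    (hst : s ≤ t) :
    ∫ x, max (w x - t) 0 ∂ν + (t - s) * ν.real {x | t < w x} ≤ ∫ x, max (w x - s) 0 ∂ν := by
  have hint : ∀ u : ℝ, Integrable (fun x => max (w x - u) 0) ν := fun u =>
    (hw.sub (integrable_const u)).pos_part
  have hmeas := nullMeasurableSet_superlevel hw t
  have hconst : Integrable ({x | t < w x}.indicator fun _ => t - s) ν :=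
    (integrable_const _).indicator₀ hmeas
  have hval : (t - s) * ν.real {x | t < w x} =
      ∫ x, {x | t < w x}.indicator (fun _ => t - s) x ∂ν := by
    rw [integral_indicator₀ hmeas]
    simp [mul_comm]
  rw [hval, ← integral_add (hint t) hconst]
  refine integral_mono ((hint t).add hconst) (hint s) fun x => ?_
  by_cases hx : t < w x
  · simp [hx, hx.le]
  · simp only [Set.mem_ofPred_eq, hx, not_false_eq_true, Set.indicator_of_notMem, add_zero]
    exact max_le_max_right _ (by linarith)

end Truncation

theorem tendsto_one_add_mul_one_sub_exp_pow (p L : ℝ) :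
    Filter.Tendsto (fun n : ℕ => (1 + p * (1 - Real.exp (-(L / n)))) ^ n) Filter.atTop
      (nhds (Real.exp (p * L))) := by
  refine Real.tendsto_one_add_pow_exp_of_tendsto ?_
  have hd : HasDerivAt (fun x : ℝ => p * (1 - Real.exp (-(L * x)))) (p * L) 0 := by
    have h := ((((hasDerivAt_id (0 : ℝ)).const_mul L).neg.exp).const_sub 1).const_mul p
    simpa using h
  have hinv : Filter.Tendsto (fun n : ℕ => ((n : ℝ))⁻¹) Filter.atTop (nhdsWithin 0 {0}ᶜ) :=
    tendsto_nhdsWithin_iff.2 ⟨tendsto_inv_atTop_nhds_zero_nat,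
      (Filter.eventually_ne_atTop 0).mono fun n hn => by simpa using hn⟩
  refine ((hasDerivAt_iff_tendsto_slope_zero.1 hd).comp hinv).congr fun n => ?_
  simp [div_eq_mul_inv]

/-- Discrete Grönwall estimate: a convex-type inequality `H t + (t - s) m t ≤ H s` together with
`p H t ≤ t m t` forces `H t * t ^ p` to be nonincreasing. -/
theorem mul_rpow_le_mul_rpow_of_forall {H m : ℝ → ℝ} {p s₀ : ℝ} (hp : 0 < p)
    (hconv : ∀ s t, s ≤ t → H t + (t - s) * m t ≤ H s)
    (hm : ∀ t, s₀ ≤ t → p * H t ≤ t * m t) {s t : ℝ} (hs₀ : s₀ ≤ s) (hs : 0 < s) (hst : s ≤ t) :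
    H t * t ^ p ≤ H s * s ^ p := by
  have hstep : ∀ ρ u, 0 < u → ρ ≤ 1 → s₀ ≤ u → (1 + p * (1 - ρ)) * H u ≤ H (ρ * u) := by
    intro ρ u hu hρ hsu
    have h1 := hconv (ρ * u) u (by nlinarith)
    nlinarith [mul_le_mul_of_nonneg_left (hm u hsu) (sub_nonneg.2 hρ)]
  have ht : 0 < t := hs.trans_le hst
  set L := Real.log (t / s) with hL
  have hL0 : 0 ≤ L := Real.log_nonneg ((one_le_div hs).2 hst)
  have hexp : Real.exp (-L) * t = s := by
    rw [Real.exp_neg, hL, Real.exp_log (div_pos ht hs)]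
    field_simp
  have hpow : ∀ n : ℕ, n ≠ 0 → (1 + p * (1 - Real.exp (-(L / n)))) ^ n * H t ≤ H s := by
    intro n hn
    set ρ := Real.exp (-(L / n)) with hρ
    have hρ0 : 0 < ρ := Real.exp_pos _
    have hρ1 : ρ ≤ 1 := Real.exp_le_one_iff.2 (by have : 0 ≤ L / n := by positivity
                                                  linarith)
    have hρn : ρ ^ n * t = s := by
      rw [hρ, ← Real.exp_nat_mul, ← hexp]
      congr 2
      field_simp
    have hind : ∀ k ≤ n, (1 + p * (1 - ρ)) ^ k * H t ≤ H (ρ ^ k * t) := by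
      intro k
      induction k with
      | zero => simp
      | succ k ih =>
        intro hk
        have hsk : s ≤ ρ ^ k * t := by
          rw [← hρn]
          exact mul_le_mul_of_nonneg_right
            (pow_le_pow_of_le_one hρ0.le hρ1 (by omega)) ht.le
        have h0 : 0 ≤ 1 + p * (1 - ρ) := by nlinarith
        calc (1 + p * (1 - ρ)) ^ (k + 1) * H t
            = (1 + p * (1 - ρ)) * ((1 + p * (1 - ρ)) ^ k * H t) := by ring
          _ ≤ (1 + p * (1 - ρ)) * H (ρ ^ k * t) :=
              mul_le_mul_of_nonneg_left (ih (by omega)) h0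
          _ ≤ H (ρ * (ρ ^ k * t)) := hstep _ _ (by positivity) hρ1 (hs₀.trans hsk)
          _ = H (ρ ^ (k + 1) * t) := by ring_nf
    simpa [hρn] using hind n le_rfl
  have hlim := (tendsto_one_add_mul_one_sub_exp_pow p L).mul_const (H t)
  have hfin : Real.exp (p * L) * H t ≤ H s := le_of_tendsto hlim
    ((Filter.eventually_ne_atTop 0).mono hpow)
  have hrpow : Real.exp (p * L) * s ^ p = t ^ p := by
    rw [mul_comm p L, Real.exp_mul, hL, Real.exp_log (div_pos ht hs),
      ← Real.mul_rpow (div_pos ht hs).le hs.le, div_mul_cancel₀ _ hs.ne']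
  calc H t * t ^ p = Real.exp (p * L) * H t * s ^ p := by rw [← hrpow]; ring
    _ ≤ H s * s ^ p := by gcongr

/-- The real-variable extrapolation giving the sharp weak-type bound at height `lam`. -/
theorem mul_rpow_le_of_forall {H m : ℝ → ℝ} {δ A L lam : ℝ} (hδ : 1 < δ) (hL : 0 < L)
    (hA : 0 ≤ A) (hlam : 0 < lam) (hH : ∀ s, 0 ≤ H s) (hm0 : ∀ s, 0 ≤ m s) (hmL : ∀ s, m s ≤ L)
    (hconv : ∀ s t, s ≤ t → H t + (t - s) * m t ≤ H s)
    (hbound : ∀ s, A / δ ≤ s → H s ≤ (δ - 1) * s * m s) :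
    lam * (m lam / L) ^ (1 / (δ / (δ - 1))) ≤ A := by
  have hδ0 : 0 < δ := by linarith
  have hδ1 : 0 < δ - 1 := by linarith
  have hr : 0 < δ / (δ - 1) := by positivity
  have hq0 : 0 ≤ m lam / L := div_nonneg (hm0 _) hL.le
  rcases le_or_gt lam A with hle | hlt
  · have : (m lam / L) ^ (1 / (δ / (δ - 1))) ≤ 1 :=
      Real.rpow_le_one hq0 ((div_le_one hL).2 (hmL _)) (by positivity)
    nlinarith
  have hstart : H (A / δ) ≤ (δ - 1) * (A / δ) * L :=
    (hbound _ le_rfl).trans (mul_le_mul_of_nonneg_left (hmL _) (by positivity))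
  have hend := hconv (lam / δ) lam (div_le_self hlam.le hδ.le)
  have hkey : m lam / L ≤ (A / lam) ^ (δ / (δ - 1)) := by
    rcases hA.eq_or_lt with rfl | hA
    · have h1 := hconv 0 lam hlam.le
      simp only [zero_div, mul_zero, zero_mul] at hstart
      have h2 : m lam = 0 := by nlinarith [hH lam, hm0 lam]
      simp [h2, hr.ne']
    have hmono := mul_rpow_le_mul_rpow_of_forall (p := 1 / (δ - 1)) (s₀ := A / δ) (by positivity)
      hconv (fun t ht => by
        have := hbound t ht
        rw [one_div_mul_eq_div, div_le_iff₀ hδ1]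
        linarith) le_rfl (by positivity) (div_le_div_of_nonneg_right hlt.le hδ0.le)
    have hexp : δ / (δ - 1) = 1 / (δ - 1) + 1 := by field_simp; ring
    rw [hexp, Real.rpow_add (by positivity), Real.rpow_one]
    set p := 1 / (δ - 1)
    rw [Real.div_rpow hlam.le hδ0.le, Real.div_rpow hA.le hδ0.le] at hmono
    rw [Real.div_rpow hA.le hlam.le]
    have hd := Real.rpow_pos_of_pos hδ0 p
    have hl := Real.rpow_pos_of_pos hlam p
    have ha := Real.rpow_pos_of_pos hA p
    rw [← mul_div_assoc, ← mul_div_assoc, div_le_div_iff_of_pos_right hd] at hmono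
    have h1 : (lam - lam / δ) * m lam * lam ^ p ≤ (δ - 1) * (A / δ) * L * A ^ p :=
      calc _ ≤ H (lam / δ) * lam ^ p := by
            gcongr
            linarith [hH lam]
        _ ≤ H (A / δ) * A ^ p := hmono
        _ ≤ _ := by gcongr
    have h2 : (lam - lam / δ) = (δ - 1) / δ * lam := by field_simp
    have h3 : (δ - 1) / δ * (lam * m lam * lam ^ p) ≤ (δ - 1) / δ * (A * L * A ^ p) := by
      rw [h2] at h1
      calc _ = (δ - 1) / δ * lam * m lam * lam ^ p := by ring
        _ ≤ _ := h1
        _ = _ := by ring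
    have h4 := le_of_mul_le_mul_left h3 (by positivity)
    rw [div_mul_div_comm, div_le_div_iff₀ hL (by positivity)]
    linarith
  calc lam * (m lam / L) ^ (1 / (δ / (δ - 1)))
      ≤ lam * ((A / lam) ^ (δ / (δ - 1))) ^ (1 / (δ / (δ - 1))) := by gcongr
    _ = lam * (A / lam) := by
        rw [← Real.rpow_mul (by positivity), mul_one_div_cancel hr.ne', Real.rpow_one]
    _ = A := mul_div_cancel₀ _ hlam.ne'

/-- Sharp endpoint weak-type reverse Hölder inequality for `A₁` weights on `ℝ`:
if `Mw ≤ δ w` a.e. and `r_w = δ/(δ-1)`, then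
`‖w‖_{L^{r_w,∞}(I,dx/|I|)} ≤ ⨍_I w` for every bounded interval `I`. -/
theorem stmt3 (w : ℝ → ℝ) (hw : ∀ x, 0 ≤ w x) (hloc : LocallyIntegrable w volume)
    (δ : ℝ) (hδ : 1 < δ)
    (hA1 : ∀ᵐ x : ℝ ∂volume, M1 w x ≤ ENNReal.ofReal (δ * w x))
    (a b : ℝ) (hab : a < b) (lam : ℝ) (hlam : 0 < lam) :
    ENNReal.ofReal lam *
        (volume {x ∈ Set.Ioo a b | lam < w x} / volume (Set.Ioo a b)) ^ (1 / (δ / (δ - 1))) ≤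
      (∫⁻ x in Set.Ioo a b, ENNReal.ofReal (w x)) / volume (Set.Ioo a b) := by
  have hδ0 : 0 < δ := by linarith
  have hL : 0 < b - a := sub_pos.2 hab
  set ν := volume.restrict (Set.Ioo a b) with hν
  have hint : Integrable w ν :=
    (hloc.integrableOn_isCompact isCompact_Icc).mono_set Set.Ioo_subset_Icc_self
  have hset : ∀ s, ν {x | s < w x} = volume {x ∈ Set.Ioo a b | s < w x} := fun s => by
    rw [hν, Measure.restrict_apply' measurableSet_Ioo, Set.inter_comm]
    rfl
  have hres : ∀ s, ν.restrict {x | s < w x} = volume.restrict {x ∈ Set.Ioo a b | s < w x} :=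
    fun s => by
      rw [hν, Measure.restrict_restrict₀ (nullMeasurableSet_superlevel hint s), Set.inter_comm]
      rfl
  have huniv : ν.real Set.univ = b - a := by
    simp [hν, Measure.real, hL.le]
  have hA0 : 0 ≤ ∫ x, w x ∂ν := integral_nonneg hw
  have hlevel : ∀ s, (∫ x, w x ∂ν) / (b - a) / δ ≤ s →
      ∫ x in {x | s < w x}, w x ∂ν ≤ δ * s * ν.real {x | s < w x} := by
    intro s hs
    have hs0 : 0 ≤ s := le_trans (by positivity) hs
    rcases (measure_mono (μ := ν) (Set.subset_univ {x | s < w x})).lt_or_eq with h | h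
    · have hlt : volume {x ∈ Set.Ioo a b | s < w x} < volume (Set.Ioo a b) := by
        rwa [hset, hν, Measure.restrict_apply_univ] at h
      have hle := setLIntegral_superlevel_le hδ0.le hw hA1 hlt
      rw [← hres, ← hset, ← ofReal_integral_eq_lintegral_ofReal hint.integrableOn
        (Filter.Eventually.of_forall hw)] at hle
      rw [← ofReal_measureReal, ← ENNReal.ofReal_mul (by positivity)] at hle
      exact (ENNReal.ofReal_le_ofReal_iff (by positivity)).1 hle
    · have hfull : ν.real {x | s < w x} = b - a := by rw [← huniv, Measure.real, h, Measure.real]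
      rw [hfull]
      rw [div_div, div_le_iff₀ (by positivity)] at hs
      calc _ ≤ ∫ x, w x ∂ν := setIntegral_le_integral hint (Filter.Eventually.of_forall hw)
        _ ≤ _ := by linarith
  have hreal := mul_rpow_le_of_forall (H := fun s => ∫ x, max (w x - s) 0 ∂ν)
    (m := fun s => ν.real {x | s < w x}) (A := (∫ x, w x ∂ν) / (b - a)) hδ hL (by positivity) hlam
    (fun s => integral_nonneg fun x => le_max_right _ _) (fun s => measureReal_nonneg)
    (fun s => huniv ▸ measureReal_mono (Set.subset_univ _))
    (fun s t hst => integral_max_sub_zero_add_le hint hst)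
    (fun s hs => by
      simp only [integral_max_sub_zero_eq hint]
      linarith [hlevel s hs])
  rw [← hset, ← ofReal_measureReal, Real.volume_Ioo, ← ofReal_integral_eq_lintegral_ofReal hint
    (Filter.Eventually.of_forall hw), ← ENNReal.ofReal_div_of_pos hL, ← ENNReal.ofReal_div_of_pos hL,
    ENNReal.ofReal_rpow_of_nonneg (by positivity) (by
      have : 0 < δ - 1 := by linarith
      positivity), ← ENNReal.ofReal_mul hlam.le]
  exact ENNReal.ofReal_le_ofReal hreal
end
end

section
/- Let w be a weight on ℝⁿ such that 0 < w(Q) < ∞ for every bounded axis-parallel cube Q, and suppose that (w)_{A∞} = 1, i.e., ∫_Q M(w·1_Q) dx ≤ w(Q) for every bounded axis-parallel cube Q. Then there exists a constant c > 0 such that w(x) = c for almost every x ∈ ℝⁿ. -/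
open MeasureTheory Set ENNReal

noncomputable section

open Filter Topology

lemma isCube_ball {n : ℕ} (x : Fin n → ℝ) {r : ℝ} (hr : 0 < r) : IsCube (Metric.ball x r) := by
  refine ⟨fun i => x i - r, 2 * r, by linarith, ?_⟩
  rw [ball_pi x hr]
  congr 1
  ext1 i
  rw [Real.ball_eq_Ioo]
  congr 1
  ring

lemma IsCube.isOpen {n : ℕ} {Q : Set (Fin n → ℝ)} (hQ : IsCube Q) : IsOpen Q := by
  obtain ⟨a, s, hs, rfl⟩ := hQ
  exact isOpen_set_pi finite_univ fun i _ => isOpen_Ioo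

lemma IsCube.nonempty {n : ℕ} {Q : Set (Fin n → ℝ)} (hQ : IsCube Q) : Q.Nonempty := by
  obtain ⟨a, s, hs, rfl⟩ := hQ
  exact ⟨fun i => a i + s / 2, fun i _ => ⟨by simp; linarith, by simp; linarith⟩⟩

lemma IsCube.volume_ne_zero {n : ℕ} {Q : Set (Fin n → ℝ)} (hQ : IsCube Q) : volume Q ≠ 0 :=
  (hQ.isOpen.measure_pos volume hQ.nonempty).ne'

lemma IsCube.volume_ne_top {n : ℕ} {Q : Set (Fin n → ℝ)} (hQ : IsCube Q) : volume Q ≠ ⊤ := by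
  obtain ⟨a, s, hs, rfl⟩ := hQ
  rw [volume_pi_pi]
  exact ENNReal.prod_ne_top fun i _ => by simp

lemma le_maximal {n : ℕ} (f : (Fin n → ℝ) → ℝ) {Q : Set (Fin n → ℝ)} (hQ : IsCube Q)
    {x : Fin n → ℝ} (hx : x ∈ Q) :
    (∫⁻ y in Q, ENNReal.ofReal |f y|) / volume Q ≤ maximal f x :=
  le_iSup_of_le Q (le_iSup_of_le hQ (le_iSup_of_le hx le_rfl))

/-- A locally integrable function is a.e. dominated by its maximal function. -/
lemma ae_ofReal_abs_le_maximal {n : ℕ} {f : (Fin n → ℝ) → ℝ} (hf : LocallyIntegrable f volume) :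
    ∀ᵐ x, ENNReal.ofReal |f x| ≤ maximal f x := by
  have hm : AEMeasurable (fun x => ENNReal.ofReal |f x|) volume :=
    hf.aestronglyMeasurable.aemeasurable.abs.ennreal_ofReal
  have hlf : IsLocallyFiniteMeasure
      ((volume : Measure (Fin n → ℝ)).withDensity fun x => ENNReal.ofReal |f x|) := by
    refine ⟨fun x => ?_⟩
    obtain ⟨s, hs, hfs⟩ := hf x
    refine ⟨s, hs, ?_⟩
    rw [withDensity_apply' _ s]
    simpa only [HasFiniteIntegral, Real.enorm_eq_ofReal_abs] using hfs.hasFiniteIntegral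
  filter_upwards [Besicovitch.ae_tendsto_rnDeriv
    ((volume : Measure (Fin n → ℝ)).withDensity fun x => ENNReal.ofReal |f x|) volume,
    Measure.rnDeriv_withDensity₀ volume hm] with x hx hx'
  rw [hx'] at hx
  refine le_of_tendsto hx ?_
  filter_upwards [self_mem_nhdsWithin] with r hr
  have hr : 0 < r := hr
  have hae : (Metric.closedBall x r : Set (Fin n → ℝ)) =ᵐ[volume] Metric.ball x r := by
    refine (ae_eq_set).2 ⟨?_, ?_⟩
    · rw [Metric.closedBall_sdiff_ball]
      exact Measure.addHaar_sphere_of_ne_zero _ _ hr.ne'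
    · rw [sdiff_eq_empty.2 Metric.ball_subset_closedBall, measure_empty]
  rw [withDensity_apply _ Metric.isClosed_closedBall.measurableSet, measure_congr hae,
    setLIntegral_congr hae]
  exact le_maximal f (isCube_ball x hr) (Metric.mem_ball_self hr)

/-- If `∫_Q M(w 1_Q) ≤ w(Q) < ∞` then `w` is a.e. equal to its mean on `Q`. -/
lemma ae_eq_mean_of_lintegral_maximal_le {n : ℕ} {w : (Fin n → ℝ) → ℝ} (hw : ∀ x, 0 ≤ w x)
    (hloc : LocallyIntegrable w volume) {Q : Set (Fin n → ℝ)} (hQ : IsCube Q)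
    (hfin : (∫⁻ x in Q, ENNReal.ofReal (w x)) ≠ ⊤)
    (hFW : (∫⁻ x in Q, maximal (Q.indicator w) x) ≤ ∫⁻ x in Q, ENNReal.ofReal (w x)) :
    ∀ᵐ x ∂volume.restrict Q,
      ENNReal.ofReal (w x) = (∫⁻ x in Q, ENNReal.ofReal (w x)) / volume Q := by
  have hQm := hQ.isOpen.measurableSet
  set c := (∫⁻ x in Q, ENNReal.ofReal (w x)) / volume Q with hc
  have hind : ∀ x ∈ Q, ENNReal.ofReal |Q.indicator w x| = ENNReal.ofReal (w x) := fun x hx => by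
    rw [indicator_of_mem hx, abs_of_nonneg (hw x)]
  have hcM : ∀ x ∈ Q, c ≤ maximal (Q.indicator w) x := fun x hx => by
    have := le_maximal (Q.indicator w) hQ hx
    rwa [setLIntegral_congr_fun hQm hind] at this
  have hwM : ∀ᵐ x ∂volume.restrict Q, ENNReal.ofReal (w x) ≤ maximal (Q.indicator w) x := by
    rw [ae_restrict_iff' hQm]
    have hli : LocallyIntegrable (Q.indicator w) volume := hloc.indicator hQm
    filter_upwards [ae_ofReal_abs_le_maximal hli] with x hx hxQ
    rwa [hind x hxQ] at hx
  have hm : AEMeasurable (fun x => ENNReal.ofReal (w x)) (volume.restrict Q) :=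
    hloc.aestronglyMeasurable.aemeasurable.ennreal_ofReal.restrict
  have hmax : AEMeasurable (fun x => max (ENNReal.ofReal (w x)) c) (volume.restrict Q) :=
    hm.max aemeasurable_const
  have hle : (∫⁻ x in Q, max (ENNReal.ofReal (w x)) c) ≤ ∫⁻ x in Q, ENNReal.ofReal (w x) := by
    refine le_trans (lintegral_mono_ae ?_) hFW
    filter_upwards [hwM, ae_restrict_mem hQm] with x hx hxQ
    exact max_le hx (hcM x hxQ)
  have hcint : (∫⁻ _ in Q, c) = ∫⁻ x in Q, ENNReal.ofReal (w x) := by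
    rw [setLIntegral_const, hc, ENNReal.div_mul_cancel hQ.volume_ne_zero hQ.volume_ne_top]
  have h1 := ae_eq_of_ae_le_of_lintegral_le (ae_of_all _ fun x => le_max_left _ c) hfin hmax hle
  have h2 := ae_eq_of_ae_le_of_lintegral_le (f := fun _ => c)
    (ae_of_all _ fun x => le_max_right (ENNReal.ofReal (w x)) c) (by rwa [hcint]) hmax
    (by rwa [hcint])
  filter_upwards [h1, h2] with x h1 h2
  exact h1.trans h2.symm

/-- A weight on `ℝⁿ` with Fujii–Wilson constant equal to `1`, i.e. satisfying
`∫_Q M(w 1_Q) ≤ w(Q)` for every cube `Q`, is a.e. equal to a positive constant. -/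
theorem stmt4 {n : ℕ} (w : (Fin n → ℝ) → ℝ) (hw : ∀ x, 0 ≤ w x)
    (hloc : LocallyIntegrable w volume)
    (hpos : ∀ Q : Set (Fin n → ℝ), IsCube Q →
      0 < ∫⁻ x in Q, ENNReal.ofReal (w x))
    (hfin : ∀ Q : Set (Fin n → ℝ), IsCube Q →
      (∫⁻ x in Q, ENNReal.ofReal (w x)) < ⊤)
    (hFW : ∀ Q : Set (Fin n → ℝ), IsCube Q →
      (∫⁻ x in Q, maximal (Q.indicator w) x) ≤ ∫⁻ x in Q, ENNReal.ofReal (w x)) :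
    ∃ c : ℝ, 0 < c ∧ ∀ᵐ x : (Fin n → ℝ) ∂volume, w x = c := by
  set m : Set (Fin n → ℝ) → ℝ≥0∞ := fun Q =>
    (∫⁻ x in Q, ENNReal.ofReal (w x)) / volume Q with hm
  have hcube : ∀ k : ℕ, IsCube (Metric.ball (0 : Fin n → ℝ) (k + 1)) := fun k =>
    isCube_ball 0 (by positivity)
  have hmean : ∀ k : ℕ, ∀ᵐ x : Fin n → ℝ, x ∈ Metric.ball (0 : Fin n → ℝ) (k + 1) →
      ENNReal.ofReal (w x) = m (Metric.ball (0 : Fin n → ℝ) (k + 1)) := fun k =>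
    (ae_restrict_iff' Metric.isOpen_ball.measurableSet).1
      (ae_eq_mean_of_lintegral_maximal_le hw hloc (hcube k) (hfin _ (hcube k)).ne
        (hFW _ (hcube k)))
  have hcst : ∀ k : ℕ, m (Metric.ball (0 : Fin n → ℝ) (k + 1)) =
      m (Metric.ball (0 : Fin n → ℝ) ((0 : ℕ) + 1)) := fun k => by
    have hne : volume (Metric.ball (0 : Fin n → ℝ) ((0 : ℕ) + 1)) ≠ 0 := (hcube 0).volume_ne_zero
    obtain ⟨x, hx, hx0, hxk⟩ := ((frequently_ae_mem_iff.2 hne).and_eventually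
      ((hmean 0).and (hmean k))).exists
    rw [← hx0 hx, ← hxk (Metric.ball_subset_ball (by simp) hx)]
  set c := m (Metric.ball (0 : Fin n → ℝ) ((0 : ℕ) + 1)) with hc
  have hc0 : c ≠ 0 := (ENNReal.div_pos (hpos _ (hcube 0)).ne' (hcube 0).volume_ne_top).ne'
  have hct : c ≠ ⊤ := ENNReal.div_ne_top (hfin _ (hcube 0)).ne (hcube 0).volume_ne_zero
  refine ⟨c.toReal, ENNReal.toReal_pos hc0 hct, ?_⟩
  filter_upwards [ae_all_iff.2 hmean] with x hx
  obtain ⟨k, hk⟩ := exists_nat_gt ‖x‖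
  have := hx k (by rw [mem_ball_zero_iff]; linarith)
  rw [← hcst k, ← this, ENNReal.toReal_ofReal (hw x)]
end
end

section
/- Let v : ℝⁿ → [0,∞) be locally integrable and let Q be a bounded axis-parallel cube. Suppose there exist λ₀ ≥ 0 and δ > 1 such that for every λ with λ₀ ≤ λ < ∞, ∫_{{x ∈ Q : v(x) > λ}} v dx ≤ δ·λ·|{x ∈ Q : v(x) > λ}|. Then for every r with 1 ≤ r < δ/(δ−1), one has (1/|Q|)∫_Q vʳ dx ≤ λ₀^{r−1} · (r′−1)/(r′−δ) · (1/|Q|)∫_Q v dx. -/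
open MeasureTheory Set ENNReal

noncomputable section

/-- Layer cake formula for the increment of `w ^ q` above a lower bound `a` of `w`. -/
theorem lintegral_rpow_sub_rpow_eq_s5 {α : Type*} [MeasurableSpace α] (ν : Measure α)
    {w : α → ℝ} (hw : AEMeasurable w ν) {a : ℝ} (ha : 0 ≤ a) (haw : ∀ x, a ≤ w x)
    {c q : ℝ} (hc : 0 ≤ c) (hq : 0 < q) :
    ∫⁻ x, ENNReal.ofReal (c * (w x ^ q - a ^ q)) ∂ν =
      ∫⁻ t in Ioi (0 : ℝ), ν {x | t + a < w x} * ENNReal.ofReal (c * q * (t + a) ^ (q - 1)) := by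
  have hint : ∀ b : ℝ, IntervalIntegrable (fun t : ℝ => c * q * (t + a) ^ (q - 1)) volume 0 b := by
    intro b
    have h := (intervalIntegral.intervalIntegrable_rpow' (a := 0 + a) (b := b + a)
      (r := q - 1) (by linarith)).comp_add_right a
    simpa using h.const_mul (c * q)
  have h := lintegral_comp_eq_lintegral_meas_lt_mul ν (f := fun x => w x - a)
    (g := fun t => c * q * (t + a) ^ (q - 1)) (ae_of_all _ fun x => sub_nonneg.2 (haw x))
    (hw.sub_const a) (fun t _ => hint t)
    (by
      filter_upwards [ae_restrict_mem measurableSet_Ioi] with t ht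
      have ht' : (0 : ℝ) < t := ht
      positivity)
  simp only [lt_sub_iff_add_lt] at h
  rw [← h]
  refine lintegral_congr fun x => ?_
  congr 1
  rw [intervalIntegral.integral_const_mul,
    intervalIntegral.integral_comp_add_right (fun t : ℝ => t ^ (q - 1)) a,
    integral_rpow (Or.inl (by linarith))]
  simp only [sub_add_cancel, zero_add]
  field_simp

/-- Comparison of the weighted and unweighted layer cake integrals for the clamped function
`max (min f M) a`. -/
theorem lintegral_clamp_mul_le {α : Type*} [MeasurableSpace α] {μ : Measure α}
    [IsFiniteMeasure μ] {f : α → ℝ} (hf : AEMeasurable f μ) {a δ : ℝ}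
    (ha : 0 ≤ a) (hδ : 1 < δ)
    (hyp : ∀ t : ℝ, a ≤ t → ∫⁻ x in {x | t < f x}, ENNReal.ofReal (f x) ∂μ ≤
      ENNReal.ofReal (δ * t) * μ {x | t < f x})
    {r : ℝ} (hr : 1 < r) (M : ℝ) :
    ∫⁻ x, ENNReal.ofReal (f x) *
        ENNReal.ofReal (max (min (f x) M) a ^ (r - 1) - a ^ (r - 1)) ∂μ ≤
      ∫⁻ x, ENNReal.ofReal (δ * (r - 1) / r * (max (min (f x) M) a ^ r - a ^ r)) ∂μ := by
  have hw : AEMeasurable (fun x => max (min (f x) M) a) μ :=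
    (hf.min aemeasurable_const).max aemeasurable_const
  have haw : ∀ x, a ≤ max (min (f x) M) a := fun x => le_max_right _ _
  have hfo : AEMeasurable (fun x => ENNReal.ofReal (f x)) μ := hf.ennreal_ofReal
  have h1 := lintegral_rpow_sub_rpow_eq_s5 (μ.withDensity fun x => ENNReal.ofReal (f x))
    (hw.mono_ac (withDensity_absolutelyContinuous _ _)) ha haw (c := 1) zero_le_one
    (sub_pos.2 hr)
  rw [lintegral_withDensity_eq_lintegral_mul₀ hfo (by fun_prop)] at h1
  simp only [Pi.mul_apply, one_mul] at h1
  rw [h1, lintegral_rpow_sub_rpow_eq_s5 μ hw ha haw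
    (div_nonneg (mul_nonneg (by linarith) (by linarith)) (by linarith)) (by linarith)]
  refine setLIntegral_mono' measurableSet_Ioi fun t ht => ?_
  have ht0 : (0 : ℝ) < t := ht
  have hta : 0 < t + a := by linarith
  have hset : μ.withDensity (fun x => ENNReal.ofReal (f x)) {x | t + a < max (min (f x) M) a} ≤
      ENNReal.ofReal (δ * (t + a)) * μ {x | t + a < max (min (f x) M) a} := by
    rw [withDensity_apply']
    by_cases hM : t + a < M
    · have : {x | t + a < max (min (f x) M) a} = {x | t + a < f x} := by
        ext x
        simp [hM, ht0.le]
      rw [this]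
      exact hyp _ (by linarith)
    · have : {x | t + a < max (min (f x) M) a} = ∅ := by
        ext x
        simp [not_lt.1 hM, ht0.le]
      rw [this]
      simp
  refine (mul_le_mul_left hset _).trans_eq ?_
  rw [mul_right_comm, mul_comm, ← ENNReal.ofReal_mul (by positivity)]
  congr 2
  have hpow : (t + a) ^ (r - 1) = (t + a) * (t + a) ^ (r - 1 - 1) := by
    rw [mul_comm, ← Real.rpow_add_one hta.ne']
    ring_nf
  rw [hpow]
  field_simp

/-- Reverse Hölder estimate for the clamped function `max (min f M) a`. -/
theorem lintegral_clamp_rpow_mul_le {α : Type*} [MeasurableSpace α] {μ : Measure α}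
    [IsFiniteMeasure μ] {f : α → ℝ} (hf : Integrable f μ) (hf0 : ∀ x, 0 ≤ f x) {a δ : ℝ}
    (ha : 0 ≤ a) (hδ : 1 < δ)
    (hyp : ∀ t : ℝ, a ≤ t → ∫⁻ x in {x | t < f x}, ENNReal.ofReal (f x) ∂μ ≤
      ENNReal.ofReal (δ * t) * μ {x | t < f x})
    {r : ℝ} (hr : 1 < r) (hrδ : 0 < δ - (δ - 1) * r) (M : ℝ) :
    ∫⁻ x, ENNReal.ofReal (max (min (f x) M) a ^ (r - 1) * f x) ∂μ ≤
      ENNReal.ofReal (a ^ (r - 1) * (1 / (δ - (δ - 1) * r))) *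
        ∫⁻ x, ENNReal.ofReal (f x) ∂μ := by
  have hcomp := lintegral_clamp_mul_le hf.aemeasurable ha hδ hyp hr M
  set w : α → ℝ := fun x => max (min (f x) M) a with hwdef
  have hfm := hf.aemeasurable
  have hw : AEMeasurable w μ := (hfm.min aemeasurable_const).max aemeasurable_const
  have haw : ∀ x, a ≤ w x := fun x => le_max_right _ _
  have hw0 : ∀ x, 0 ≤ w x := fun x => ha.trans (haw x)
  have hwM : ∀ x, w x ≤ max M a := fun x => max_le_max_right _ (min_le_right _ _)
  have hbound : ∀ q : ℝ, 0 ≤ q → ∀ x, ‖w x ^ q‖ ≤ max M a ^ q := fun q hq x => by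
    rw [Real.norm_of_nonneg (Real.rpow_nonneg (hw0 x) q)]
    exact Real.rpow_le_rpow (hw0 x) (hwM x) hq
  have hmono : ∀ q : ℝ, 0 ≤ q → ∀ x, 0 ≤ w x ^ q - a ^ q := fun q hq x =>
    sub_nonneg.2 (Real.rpow_le_rpow ha (haw x) hq)
  have hwr : Integrable (fun x => w x ^ r) μ :=
    Integrable.of_bound (hw.pow_const r).aestronglyMeasurable _
      (ae_of_all _ (hbound r (by linarith)))
  have hwf : Integrable (fun x => w x ^ (r - 1) * f x) μ :=
    hf.bdd_mul (hw.pow_const _).aestronglyMeasurable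
      (ae_of_all _ (hbound (r - 1) (by linarith)))
  have hpow : ∀ x : ℝ, 0 ≤ x → x ^ r = x ^ (r - 1) * x := fun x hx => by
    rw [← Real.rpow_add_one' hx (by linarith), sub_add_cancel]
  have hB : Integrable (fun x => (w x ^ (r - 1) - a ^ (r - 1)) * f x) μ := by
    simp only [sub_mul]
    exact hwf.sub (hf.const_mul (a ^ (r - 1)))
  have hD : Integrable (fun x => w x ^ r - a ^ r) μ := hwr.sub (integrable_const _)
  set S : Set α := {x | a < f x} with hS
  have hSm : NullMeasurableSet S μ := nullMeasurableSet_lt aemeasurable_const hfm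
  have hE : Integrable (S.indicator fun x => f x - a) μ :=
    (hf.sub (integrable_const a)).indicator₀ hSm
  have hc : 0 ≤ δ * (r - 1) / r :=
    div_nonneg (mul_nonneg (by linarith) (by linarith)) (by linarith)
  have key : ∫ x, (w x ^ (r - 1) - a ^ (r - 1)) * f x ∂μ ≤
      δ * (r - 1) / r * ∫ x, (w x ^ r - a ^ r) ∂μ := by
    rw [← integral_const_mul, ← ENNReal.ofReal_le_ofReal_iff
      (integral_nonneg fun x => mul_nonneg hc (hmono r (by linarith) x)),
      ofReal_integral_eq_lintegral_ofReal hB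
        (ae_of_all _ fun x => mul_nonneg (hmono _ (by linarith) x) (hf0 x)),
      ofReal_integral_eq_lintegral_ofReal (hD.const_mul _)
        (ae_of_all _ fun x => mul_nonneg hc (hmono r (by linarith) x))]
    refine le_trans (le_of_eq (lintegral_congr fun x => ?_)) hcomp
    rw [mul_comm, ENNReal.ofReal_mul (hf0 x)]
  have hDB : ∫ x, (w x ^ r - a ^ r) ∂μ ≤ ∫ x, (w x ^ (r - 1) - a ^ (r - 1)) * f x ∂μ +
      a ^ (r - 1) * (∫ x in S, f x ∂μ - a * μ.real S) := by
    have hSint : ∫ x in S, f x ∂μ - a * μ.real S = ∫ x, S.indicator (fun x => f x - a) x ∂μ := by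
      rw [integral_indicator₀ hSm, integral_sub hf.integrableOn (integrable_const a)]
      simp [mul_comm]
    rw [hSint, ← integral_const_mul, ← integral_add hB (hE.const_mul _)]
    refine integral_mono hD (hB.add (hE.const_mul _)) fun x => ?_
    by_cases hx : a < f x
    · have hxS : x ∈ S := hx
      have hwx : w x ≤ f x := max_le (min_le_left _ _) hx.le
      have := mul_le_mul_of_nonneg_left hwx (Real.rpow_nonneg (hw0 x) (r - 1))
      simp only [indicator_of_mem hxS, hpow _ (hw0 x), hpow a ha]
      linarith
    · have hxS : x ∉ S := hx
      have hwx : w x = a := max_eq_right ((min_le_left _ _).trans (not_lt.1 hx))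
      simp [indicator_of_notMem hxS, hwx]
  have hSle : ∫ x in S, f x ∂μ ≤ δ * a * μ.real S := by
    rw [← ENNReal.ofReal_le_ofReal_iff (by positivity),
      ofReal_integral_eq_lintegral_ofReal hf.integrableOn (ae_of_all _ hf0),
      ENNReal.ofReal_mul (by positivity), ofReal_measureReal]
    exact hyp a le_rfl
  have hSf : ∫ x in S, f x ∂μ ≤ ∫ x, f x ∂μ := setIntegral_le_integral hf (ae_of_all _ hf0)
  have hsplit : ∫ x, (w x ^ (r - 1) - a ^ (r - 1)) * f x ∂μ =
      ∫ x, w x ^ (r - 1) * f x ∂μ - a ^ (r - 1) * ∫ x, f x ∂μ := by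
    simp only [sub_mul]
    rw [integral_sub hwf (hf.const_mul _), integral_const_mul]
  rw [← ofReal_integral_eq_lintegral_ofReal hwf
      (ae_of_all _ fun x => mul_nonneg (Real.rpow_nonneg (hw0 x) _) (hf0 x)),
    ← ofReal_integral_eq_lintegral_ofReal hf (ae_of_all _ hf0),
    ← ENNReal.ofReal_mul (by positivity)]
  refine ENNReal.ofReal_le_ofReal ?_
  rw [hsplit] at key hDB
  set I := ∫ x, w x ^ (r - 1) * f x ∂μ
  set J := ∫ x, f x ∂μ
  set s := ∫ x in S, f x ∂μ
  set D := ∫ x, (w x ^ r - a ^ r) ∂μ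
  have hp : 0 ≤ a ^ (r - 1) := Real.rpow_nonneg ha _
  set p := a ^ (r - 1)
  have key' : r * (I - p * J) ≤ δ * (r - 1) * D := by
    have := mul_le_mul_of_nonneg_left key (by linarith : 0 ≤ r)
    rwa [← mul_assoc, mul_div_cancel₀ _ (by linarith : r ≠ 0)] at this
  have h1 : δ * (r - 1) * D ≤ δ * (r - 1) * (I - p * J + p * (s - a * μ.real S)) :=
    mul_le_mul_of_nonneg_left hDB (mul_nonneg (by linarith) (by linarith))
  have h2 : (r - 1) * p * s ≤ (r - 1) * p * (δ * a * μ.real S) :=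
    mul_le_mul_of_nonneg_left hSle (mul_nonneg (by linarith) hp)
  have h3 : (r - 1) * (δ - 1) * p * s ≤ (r - 1) * (δ - 1) * p * J :=
    mul_le_mul_of_nonneg_left hSf
      (mul_nonneg (mul_nonneg (by linarith) (by linarith)) hp)
  rw [mul_one_div, div_mul_eq_mul_div, le_div_iff₀ hrδ]
  linarith

/-- If a nonnegative integrable `f` satisfies `∫_{f > t} f ≤ δ t μ{f > t}` for all `t ≥ a`, then
`∫ f ^ r ≤ a ^ (r - 1) / (δ - (δ - 1) r) ∫ f`. -/
theorem lintegral_rpow_le_of_superlevel_s5 {α : Type*} [MeasurableSpace α] {μ : Measure α}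
    [IsFiniteMeasure μ] {f : α → ℝ} (hf : Integrable f μ) (hf0 : ∀ x, 0 ≤ f x) {a δ : ℝ}
    (ha : 0 ≤ a) (hδ : 1 < δ)
    (hyp : ∀ t : ℝ, a ≤ t → ∫⁻ x in {x | t < f x}, ENNReal.ofReal (f x) ∂μ ≤
      ENNReal.ofReal (δ * t) * μ {x | t < f x})
    {r : ℝ} (hr : 1 < r) (hrδ : 0 < δ - (δ - 1) * r) :
    ∫⁻ x, ENNReal.ofReal (f x ^ r) ∂μ ≤
      ENNReal.ofReal (a ^ (r - 1) * (1 / (δ - (δ - 1) * r))) *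
        ∫⁻ x, ENNReal.ofReal (f x) ∂μ := by
  have hfm := hf.aemeasurable
  calc ∫⁻ x, ENNReal.ofReal (f x ^ r) ∂μ
      ≤ ∫⁻ x, Filter.liminf (fun k : ℕ =>
          ENNReal.ofReal (max (min (f x) k) a ^ (r - 1) * f x)) Filter.atTop ∂μ := by
        refine lintegral_mono fun x => Filter.le_liminf_of_le (by isBoundedDefault) ?_
        obtain ⟨N, hN⟩ := exists_nat_ge (f x)
        filter_upwards [Filter.eventually_ge_atTop N] with k hk
        have hk' : f x ≤ k := hN.trans (by exact_mod_cast hk)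
        refine ENNReal.ofReal_le_ofReal ?_
        rw [min_eq_left hk', ← sub_add_cancel r 1, Real.rpow_add_one' (hf0 x) (by linarith),
          add_sub_cancel_right]
        exact mul_le_mul_of_nonneg_right
          (Real.rpow_le_rpow (hf0 x) (le_max_left _ _) (by linarith)) (hf0 x)
    _ ≤ Filter.liminf (fun k : ℕ =>
          ∫⁻ x, ENNReal.ofReal (max (min (f x) k) a ^ (r - 1) * f x) ∂μ) Filter.atTop :=
        lintegral_liminf_le' fun k => by fun_prop
    _ ≤ _ := Filter.liminf_le_of_le (by isBoundedDefault) fun b hb => by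
        obtain ⟨k, hk⟩ := hb.exists
        exact hk.trans (lintegral_clamp_rpow_mul_le hf hf0 ha hδ hyp hr hrδ k)

/-- The main lemma: superlevel-set estimates
`∫_{ {v > λ} ∩ Q } v ≤ δ λ |{v > λ} ∩ Q|` for `λ ≥ λ₀` imply the reverse Hölder
inequality `⨍_Q v^r ≤ λ₀^{r-1} (r'-1)/(r'-δ) ⨍_Q v` for `1 ≤ r < δ/(δ-1)`.
The constant `(r'-1)/(r'-δ)` is written in the equivalent form `1/(δ-(δ-1)r)`,
valid also at `r = 1`. -/
theorem stmt5 {n : ℕ} (v : (Fin n → ℝ) → ℝ) (hv : ∀ x, 0 ≤ v x)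
    (hloc : LocallyIntegrable v volume) (Q : Set (Fin n → ℝ)) (hQ : IsCube Q)
    (lam0 δ : ℝ) (hlam0 : 0 ≤ lam0) (hδ : 1 < δ)
    (hyp : ∀ lam : ℝ, lam0 ≤ lam →
      (∫⁻ x in {x ∈ Q | lam < v x}, ENNReal.ofReal (v x)) ≤
        ENNReal.ofReal (δ * lam) * volume {x ∈ Q | lam < v x})
    (r : ℝ) (hr1 : 1 ≤ r) (hr2 : r < δ / (δ - 1)) :
    (∫⁻ x in Q, ENNReal.ofReal (v x ^ r)) / volume Q ≤
      ENNReal.ofReal (lam0 ^ (r - 1) * (1 / (δ - (δ - 1) * r))) *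
        ((∫⁻ x in Q, ENNReal.ofReal (v x)) / volume Q) := by
  have hQm : MeasurableSet Q := by
    obtain ⟨b, s, -, rfl⟩ := hQ
    exact MeasurableSet.univ_pi fun i => measurableSet_Ioo
  obtain ⟨K, hK, hQK⟩ : ∃ K : Set (Fin n → ℝ), IsCompact K ∧ Q ⊆ K := by
    obtain ⟨b, s, -, rfl⟩ := hQ
    exact ⟨_, isCompact_univ_pi fun i => isCompact_Icc (a := b i) (b := b i + s),
      Set.pi_mono fun i _ => Ioo_subset_Icc_self⟩
  have hint : Integrable v (volume.restrict Q) :=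
    (hloc.integrableOn_isCompact hK).mono_set hQK
  have : IsFiniteMeasure (volume.restrict Q) :=
    ⟨by simpa using (measure_mono hQK).trans_lt hK.measure_lt_top⟩
  rcases hr1.eq_or_lt with rfl | hr
  · simp
  rw [← mul_div_assoc]
  refine ENNReal.div_le_div_right ?_ _
  have hrδ : 0 < δ - (δ - 1) * r := by
    rw [lt_div_iff₀ (by linarith)] at hr2
    linarith
  refine lintegral_rpow_le_of_superlevel_s5 hint hv hlam0 hδ (fun t ht => ?_) hr hrδ
  rw [Measure.restrict_restrict' hQm, Measure.restrict_apply' hQm, inter_comm]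
  exact hyp t ht
end
end

section
/- Let v ≥ 0 be locally integrable on ℝ, let I be a bounded interval, and let λ > 0. Let (a,b) be a connected component of the open set {x ∈ ℝ : M⁻(v·1_I)(x) > λ}; then (a,b) is a bounded interval, for every x ∈ (a,b] one has (1/(x−a))∫_a^x v·1_I ≥ λ, and moreover ∫_{(a,b)} v·1_I = λ·(b−a). -/
open MeasureTheory Set ENNReal

noncomputable section

/-- The one-sided (backward) Hardy–Littlewood maximal operator on `ℝ`:
`M⁻f(x) = sup_{h>0} (1/h) ∫_{x-h}^x |f|`. -/
def Mminus (f : ℝ → ℝ) (x : ℝ) : ℝ≥0∞ :=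
  ⨆ (h : ℝ) (_ : 0 < h),
    (∫⁻ y in Set.Ioo (x - h) x, ENNReal.ofReal |f y|) / ENNReal.ofReal h

/-- The component of a point in an open subset of `ℝ` whose complement meets both sides. -/
lemma exists_connectedComponentIn_eq_Ioo_s6 {E : Set ℝ} (hE : IsOpen E) {x₀ l r : ℝ}
    (hx₀ : x₀ ∈ E) (hl : l ∉ E) (hlx : l ≤ x₀) (hr : r ∉ E) (hxr : x₀ ≤ r) :
    ∃ a b : ℝ, a < b ∧ a ∉ E ∧ b ∉ E ∧ Ioo a b ⊆ E ∧ connectedComponentIn E x₀ = Ioo a b := by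
  obtain ⟨a, ⟨⟨-, hax⟩, haE⟩, ha⟩ := (isCompact_Icc.inter_right hE.isClosed_compl
    : IsCompact (Icc l x₀ ∩ Eᶜ)).exists_isGreatest ⟨l, ⟨le_rfl, hlx⟩, hl⟩
  obtain ⟨b, ⟨⟨hxb, -⟩, hbE⟩, hb⟩ := (isCompact_Icc.inter_right hE.isClosed_compl
    : IsCompact (Icc x₀ r ∩ Eᶜ)).exists_isLeast ⟨r, ⟨hxr, le_rfl⟩, hr⟩
  have hla : l ≤ a := ha ⟨⟨le_rfl, hlx⟩, hl⟩
  have hbr : b ≤ r := hb ⟨⟨hxr, le_rfl⟩, hr⟩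
  have hax' : a < x₀ := lt_of_le_of_ne hax fun h ↦ haE (h ▸ hx₀)
  have hxb' : x₀ < b := lt_of_le_of_ne hxb fun h ↦ hbE (h ▸ hx₀)
  have hsub : Ioo a b ⊆ E := by
    intro y hy
    by_contra hyE
    rcases le_total y x₀ with h | h
    · exact hy.1.not_ge (ha ⟨⟨hla.trans hy.1.le, h⟩, hyE⟩)
    · exact hy.2.not_ge (hb ⟨⟨h, hy.2.le.trans hbr⟩, hyE⟩)
  refine ⟨a, b, hax'.trans hxb', haE, hbE, hsub, Subset.antisymm ?_ ?_⟩
  · have hord := (isPreconnected_connectedComponentIn (x := x₀) (F := E)).ordConnected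
    have hmem := mem_connectedComponentIn hx₀
    refine fun y hy ↦ ⟨?_, ?_⟩
    · by_contra! h
      exact haE (connectedComponentIn_subset E x₀ (hord.out hy hmem ⟨h, hax⟩))
    · by_contra! h
      exact hbE (connectedComponentIn_subset E x₀ (hord.out hmem hy ⟨hxb, h⟩))
  · exact isPreconnected_Ioo.subset_connectedComponentIn ⟨hax', hxb'⟩ hsub

lemma isOpen_setOf_exists_lt_and_lt {G : ℝ → ℝ} (hG : Continuous G) :
    IsOpen {x | ∃ y < x, G y < G x} := by
  have : {x | ∃ y < x, G y < G x} = ⋃ y, Ioi y ∩ {x | G y < G x} := by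
    ext x
    simp
  rw [this]
  exact isOpen_iUnion fun y ↦ isOpen_Ioi.inter (isOpen_lt continuous_const hG)

/-- F. Riesz's rising sun lemma for a continuous function, on an interval all of whose points
are preceded by a point where the function is smaller. -/
lemma left_le_of_Ioo_subset {G : ℝ → ℝ} (hG : Continuous G) {a b : ℝ}
    (ha : a ∉ {x | ∃ y < x, G y < G x}) (hab : Ioo a b ⊆ {x | ∃ y < x, G y < G x})
    {x : ℝ} (hx : x ∈ Ioc a b) : G a ≤ G x := by
  simp only [mem_ofPred_eq, not_exists, not_and, not_lt] at ha
  have hIoo : ∀ x ∈ Ioo a b, G a ≤ G x := by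
    intro x hx
    by_contra! hlt
    obtain ⟨z, hz, hmin⟩ := isCompact_Icc.exists_isMinOn (nonempty_Icc.2 hx.1.le)
      hG.continuousOn
    have hzx : G z ≤ G x := hmin (right_mem_Icc.2 hx.1.le)
    have haz : a < z := lt_of_le_of_ne hz.1 (by rintro rfl; linarith)
    obtain ⟨y, hyz, hy⟩ := hab ⟨haz, hz.2.trans_lt hx.2⟩
    rcases lt_or_ge y a with h | h
    · linarith [ha y h]
    · exact hy.not_ge (hmin ⟨h, hyz.le.trans hz.2⟩)
  have hlt : a < b := hx.1.trans_le hx.2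
  have hIcc : Icc a b ⊆ {x | G a ≤ G x} := by
    rw [← closure_Ioo hlt.ne]
    exact closure_minimal hIoo (isClosed_le continuous_const hG)
  exact hIcc ⟨hx.1.le, hx.2⟩

lemma lintegral_Ioo_ofReal_eq_intervalIntegral {g : ℝ → ℝ} (hg : Integrable g)
    (hg0 : ∀ x, 0 ≤ g x) {a b : ℝ} (hab : a ≤ b) :
    ∫⁻ y in Ioo a b, ENNReal.ofReal (g y) = ENNReal.ofReal (∫ y in a..b, g y) := by
  rw [intervalIntegral.integral_of_le hab, integral_Ioc_eq_integral_Ioo,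
    ofReal_integral_eq_lintegral_ofReal hg.integrableOn (ae_of_all _ hg0)]

/-- The superlevel sets of `Mminus g`, in terms of a primitive of `g`. -/
lemma ofReal_lt_Mminus_iff {g : ℝ → ℝ} (hg : Integrable g) (hg0 : ∀ x, 0 ≤ g x)
    {lam : ℝ} (hlam : 0 < lam) (x : ℝ) :
    ENNReal.ofReal lam < Mminus g x ↔
      ∃ y < x, (∫ t in 0..y, g t) - lam * y < (∫ t in 0..x, g t) - lam * x := by
  have key : ∀ h > 0, (ENNReal.ofReal lam <
      (∫⁻ y in Ioo (x - h) x, ENNReal.ofReal |g y|) / ENNReal.ofReal h ↔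
      (∫ t in 0..(x - h), g t) - lam * (x - h) < (∫ t in 0..x, g t) - lam * x) := by
    intro h hh
    simp only [abs_of_nonneg (hg0 _)]
    rw [lintegral_Ioo_ofReal_eq_intervalIntegral hg hg0 (by linarith),
      ← ENNReal.ofReal_div_of_pos hh, ENNReal.ofReal_lt_ofReal_iff_of_nonneg hlam.le,
      lt_div_iff₀ hh, ← intervalIntegral.integral_interval_sub_left
        (hg.intervalIntegrable (a := 0)) (hg.intervalIntegrable (a := 0))]
    constructor <;> intro _ <;> linarith
  simp only [Mminus, lt_iSup_iff]
  constructor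
  · rintro ⟨h, hh, hlt⟩
    exact ⟨x - h, by linarith, (key h hh).1 hlt⟩
  · rintro ⟨y, hy, hlt⟩
    refine ⟨x - y, sub_pos.2 hy, (key _ (sub_pos.2 hy)).2 ?_⟩
    simpa using hlt

/-- Rising sun lemma for `M⁻`: each connected component of
`{x : M⁻(v·1_I)(x) > λ}` is a bounded open interval `(a,b)`, on which
`⨍_{(a,x)} v·1_I ≥ λ` for all `x ∈ (a,b]`, and `∫_{(a,b)} v·1_I = λ (b-a)`. -/
theorem stmt6 (v : ℝ → ℝ) (hv : ∀ x, 0 ≤ v x) (hloc : LocallyIntegrable v volume)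
    (I : Set ℝ) (hI : I.OrdConnected) (hIb : Bornology.IsBounded I)
    (lam : ℝ) (hlam : 0 < lam) (x₀ : ℝ)
    (hx₀ : x₀ ∈ {x : ℝ | ENNReal.ofReal lam < Mminus (I.indicator v) x}) :
    ∃ a b : ℝ, a < b ∧
      connectedComponentIn {x : ℝ | ENNReal.ofReal lam < Mminus (I.indicator v) x} x₀ =
        Set.Ioo a b ∧
      (∀ x ∈ Set.Ioc a b,
        ENNReal.ofReal lam ≤
          (∫⁻ y in Set.Ioo a x, ENNReal.ofReal (I.indicator v y)) / ENNReal.ofReal (x - a)) ∧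
      (∫⁻ y in Set.Ioo a b, ENNReal.ofReal (I.indicator v y)) =
        ENNReal.ofReal lam * ENNReal.ofReal (b - a) := by
  set g := I.indicator v with hgdef
  have hg0 : ∀ x, 0 ≤ g x := indicator_nonneg fun x _ ↦ hv x
  have hg : Integrable g := by
    rw [hgdef, integrable_indicator_iff hI.measurableSet]
    exact (hloc.integrableOn_isCompact hIb.isCompact_closure).mono_set subset_closure
  have hii : ∀ a b, IntervalIntegrable g volume a b := fun _ _ ↦ hg.intervalIntegrable
  set G : ℝ → ℝ := fun x ↦ (∫ t in 0..x, g t) - lam * x with hGdef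
  have hGc : Continuous G :=
    (intervalIntegral.continuous_primitive hii 0).sub (continuous_const.mul continuous_id)
  have hGsub : ∀ x y, G y - G x = (∫ t in x..y, g t) - lam * (y - x) := by
    intro x y
    simp only [hGdef]
    rw [← intervalIntegral.integral_interval_sub_left (hii 0 y) (hii 0 x)]
    ring
  have hE : {x : ℝ | ENNReal.ofReal lam < Mminus g x} = {x | ∃ y < x, G y < G x} := by
    ext x
    exact ofReal_lt_Mminus_iff hg hg0 hlam x
  rw [hE] at hx₀ ⊢
  obtain ⟨l, hl⟩ := hIb.bddBelow
  obtain ⟨u, hu⟩ := hIb.bddAbove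
  have hle : ∀ x y, x ≤ y → ∫ t in x..y, g t ≤ ∫ t, g t := by
    intro x y hxy
    rw [intervalIntegral.integral_of_le hxy]
    exact setIntegral_le_integral hg (ae_of_all _ hg0)
  have hzero_left : ∀ x y, y < l → x ≤ y → ∫ t in x..y, g t = 0 := by
    intro x y hy hxy
    refine intervalIntegral.integral_zero_ae (ae_of_all _ fun t ht ↦ ?_)
    rw [uIoc_of_le hxy] at ht
    exact indicator_of_notMem (fun h ↦ by linarith [hl h, ht.2]) _
  have hzero_right : ∀ x y, u ≤ x → x ≤ y → ∫ t in x..y, g t = 0 := by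
    intro x y hx hxy
    refine intervalIntegral.integral_zero_ae (ae_of_all _ fun t ht ↦ ?_)
    rw [uIoc_of_le hxy] at ht
    exact indicator_of_notMem (fun h ↦ by linarith [hu h, ht.1]) _
  have hleft : min (l - 1) x₀ ∉ {x | ∃ y < x, G y < G x} := by
    rintro ⟨y, hy, hlt⟩
    have h := hGsub y (min (l - 1) x₀)
    rw [hzero_left _ _ (by linarith [min_le_left (l - 1) x₀]) hy.le] at h
    nlinarith
  have hright : max (u + (∫ t, g t) / lam) x₀ ∉ {x | ∃ y < x, G y < G x} := by
    set r := max (u + (∫ t, g t) / lam) x₀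
    rintro ⟨y, hy, hlt⟩
    have h := hGsub y r
    rcases le_total u y with huy | hyu
    · rw [hzero_right _ _ huy hy.le] at h
      nlinarith
    · have h1 : (∫ t, g t) / lam ≤ r - y := by
        linarith [le_max_left (u + (∫ t, g t) / lam) x₀]
      rw [div_le_iff₀ hlam] at h1
      linarith [hle y r hy.le]
  obtain ⟨a, b, hab, ha, hb, hsub, hcomp⟩ :=
    exists_connectedComponentIn_eq_Ioo_s6 (isOpen_setOf_exists_lt_and_lt hGc) hx₀ hleft
      (min_le_right _ _) hright (le_max_right _ _)
  have hGa : ∀ x ∈ Ioc a b, G a ≤ G x := fun x hx ↦ left_le_of_Ioo_subset hGc ha hsub hx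
  refine ⟨a, b, hab, hcomp, fun x hx ↦ ?_, ?_⟩
  · have hax : 0 < x - a := sub_pos.2 hx.1
    rw [lintegral_Ioo_ofReal_eq_intervalIntegral hg hg0 hx.1.le, ← ENNReal.ofReal_div_of_pos hax]
    refine ENNReal.ofReal_le_ofReal ((le_div_iff₀ hax).2 ?_)
    linarith [hGa x hx, hGsub a x]
  · have hba : G b ≤ G a := not_lt.1 fun h ↦ hb ⟨a, hab, h⟩
    rw [lintegral_Ioo_ofReal_eq_intervalIntegral hg hg0 hab.le, ← ENNReal.ofReal_mul hlam.le]
    congr 1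
    linarith [hGa b ⟨hab, le_rfl⟩, hGsub a b]
end
end

section
/- Let f ≥ 0 be integrable on ℝ with compact support and let λ > 0. Set E_λ = {x ∈ ℝ : Mf(x) > λ}. Then every connected component of E_λ is a bounded open interval, and: (i) if J is an interval with (1/|J|)∫_J f > λ, then J is contained in a single connected component of E_λ; consequently, if an interval J meets the complement of a component (a,b), then (1/|J|)∫_J f ≤ λ; (ii) for each component (a,b) and every x ∈ [a,b], (1/(x−a))∫_a^x f ≤ λ and (1/(b−x))∫_x^b f ≤ λ; (iii) for every x in a component (a,b), Mf(x) = M(f·1_{(a,b)})(x). -/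
open MeasureTheory Set ENNReal

noncomputable section

/-- The superlevel set `E_λ = {Mf > λ}`. -/
def Elam (f : ℝ → ℝ) (lam : ℝ) : Set ℝ := {x : ℝ | ENNReal.ofReal lam < M1 f x}

lemma mem_Elam_iff {f : ℝ → ℝ} {lam x : ℝ} :
    x ∈ Elam f lam ↔ ∃ a b : ℝ, x ∈ Ioo a b ∧
      ENNReal.ofReal lam < (∫⁻ y in Ioo a b, ENNReal.ofReal |f y|) / volume (Ioo a b) := by
  simp only [Elam, M1, mem_ofPred_eq, lt_iSup_iff]
  constructor
  · rintro ⟨a, b, -, hx, h⟩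
    exact ⟨a, b, hx, h⟩
  · rintro ⟨a, b, hx, h⟩
    exact ⟨a, b, hx.1.trans hx.2, hx, h⟩

lemma Ioo_subset_Elam {f : ℝ → ℝ} {lam a b : ℝ}
    (h : ENNReal.ofReal lam < (∫⁻ y in Ioo a b, ENNReal.ofReal |f y|) / volume (Ioo a b)) :
    Ioo a b ⊆ Elam f lam :=
  fun _ hx => mem_Elam_iff.2 ⟨a, b, hx, h⟩

lemma isOpen_Elam (f : ℝ → ℝ) (lam : ℝ) : IsOpen (Elam f lam) := by
  refine isOpen_iff_mem_nhds.2 fun x hx => ?_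
  obtain ⟨a, b, hx, h⟩ := mem_Elam_iff.1 hx
  exact Filter.mem_of_superset (isOpen_Ioo.mem_nhds hx) (Ioo_subset_Elam h)

lemma ofReal_lt_div_volume_Ioo_iff {lam a b : ℝ} {I : ℝ≥0∞} (hab : a < b) :
    ENNReal.ofReal lam < I / volume (Ioo a b) ↔
      ENNReal.ofReal lam * ENNReal.ofReal (b - a) < I := by
  rw [Real.volume_Ioo]
  exact ENNReal.lt_div_iff_mul_lt (Or.inl (by simpa using hab)) (Or.inl ofReal_ne_top)

lemma isBounded_Elam {f : ℝ → ℝ} (hfi : Integrable f) (hfc : HasCompactSupport f) {lam : ℝ}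
    (hlam : 0 < lam) : Bornology.IsBounded (Elam f lam) := by
  obtain ⟨R, hR⟩ := hfc.isCompact.isBounded.subset_closedBall (0 : ℝ)
  have hfin := hfi.abs.lintegral_lt_top
  set I := ∫⁻ y, ENNReal.ofReal |f y|
  refine (Metric.isBounded_closedBall (x := (0 : ℝ)) (r := R + I.toReal / lam)).subset
    fun x hx => ?_
  obtain ⟨a, b, hx, h⟩ := mem_Elam_iff.1 hx
  rw [ofReal_lt_div_volume_Ioo_iff (hx.1.trans hx.2)] at h
  have hlen : b - a < I.toReal / lam := by
    have hI := h.trans_le (setLIntegral_le_lintegral _ _)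
    rw [← ofReal_mul hlam.le, ofReal_lt_iff_lt_toReal
      (mul_nonneg hlam.le (sub_nonneg.2 (hx.1.trans hx.2).le)) hfin.ne] at hI
    rwa [lt_div_iff₀' hlam]
  obtain ⟨z, hz, hfz⟩ : ∃ z ∈ Ioo a b, f z ≠ 0 := by
    by_contra! hzero
    rw [setLIntegral_congr_fun (g := fun _ => 0) measurableSet_Ioo
      (fun z hz => by simp [hzero z hz])] at h
    simp at h
  have hzR := hR (subset_tsupport f hfz)
  rw [mem_closedBall_zero_iff, Real.norm_eq_abs, abs_le] at hzR ⊢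
  constructor <;> linarith [hzR.1, hzR.2, hx.1, hx.2, hz.1, hz.2]

lemma IsPreconnected.exists_eq_Ioo {s : Set ℝ} (hs : IsPreconnected s) (ho : IsOpen s)
    (hb : Bornology.IsBounded s) (hne : s.Nonempty) : ∃ a b : ℝ, a < b ∧ s = Ioo a b := by
  have heq : s = Ioo (sInf s) (sSup s) := by
    refine Subset.antisymm ?_ (IsConnected.Ioo_csInf_csSup_subset ⟨hne, hs⟩ hb.bddBelow hb.bddAbove)
    rw [← interior_Icc]
    exact interior_maximal (subset_Icc_csInf_csSup hb.bddBelow hb.bddAbove) ho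
  refine ⟨sInf s, sSup s, ?_, heq⟩
  obtain ⟨x, hx⟩ := hne
  rw [heq] at hx
  exact hx.1.trans hx.2

lemma subset_connectedComponentIn_of_inter_nonempty {X : Type*} [TopologicalSpace X]
    {s F : Set X} {x : X} (hs : IsPreconnected s) (hsF : s ⊆ F)
    (h : (s ∩ connectedComponentIn F x).Nonempty) : s ⊆ connectedComponentIn F x := by
  obtain ⟨z, hzs, hz⟩ := h
  rw [connectedComponentIn_eq hz]
  exact hs.subset_connectedComponentIn hzs hsF

lemma disjoint_frontier_connectedComponentIn {X : Type*} [TopologicalSpace X]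
    [LocallyConnectedSpace X] {F : Set X} (hF : IsOpen F) (x : X) :
    Disjoint F (frontier (connectedComponentIn F x)) := by
  refine disjoint_left.2 fun y hyF hy => ?_
  have ho := hF.connectedComponentIn (x := y)
  have hmeet := mem_closure_iff.1 hy.1 _ ho (mem_connectedComponentIn hyF)
  have hsub := subset_connectedComponentIn_of_inter_nonempty
    isPreconnected_connectedComponentIn (connectedComponentIn_subset F y) hmeet
  rw [frontier, hF.connectedComponentIn.interior_eq] at hy
  exact hy.2 (hsub (mem_connectedComponentIn hyF))

/-- If the average over `(c, d)` exceeds `λ`, then so does the average over a slightly longer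
interval. -/
lemma Icc_subset_Elam {f : ℝ → ℝ} {lam c d : ℝ} (hlam : 0 < lam) (hcd : c < d)
    (h : ENNReal.ofReal lam < (∫⁻ y in Ioo c d, ENNReal.ofReal |f y|) / volume (Ioo c d)) :
    Icc c d ⊆ Elam f lam := by
  rw [ofReal_lt_div_volume_Ioo_iff hcd, ← ofReal_mul hlam.le] at h
  obtain ⟨r, hr0, hr, hrI⟩ := ENNReal.lt_iff_exists_real_btwn.1 h
  rw [ofReal_lt_ofReal_iff_of_nonneg (mul_nonneg hlam.le (sub_nonneg.2 hcd.le)),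
    ← lt_div_iff₀' hlam] at hr
  set ε := (r / lam - (d - c)) / 2 with hε
  have hε0 : 0 < ε := by linarith
  have hsub : Ioo c d ⊆ Ioo (c - ε) (d + ε) := Ioo_subset_Ioo (by linarith) (by linarith)
  refine Subset.trans (Icc_subset_Ioo (by linarith) (by linarith)) (Ioo_subset_Elam
    (a := c - ε) (b := d + ε) ?_)
  rw [ofReal_lt_div_volume_Ioo_iff (by linarith), ← ofReal_mul hlam.le,
    show d + ε - (c - ε) = r / lam by rw [hε]; ring, mul_div_cancel₀ _ hlam.ne']
  exact hrI.trans_le (lintegral_mono_set hsub)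

lemma setLIntegral_div_le_of_notMem_Elam {f : ℝ → ℝ} {lam c d z : ℝ} (hlam : 0 < lam)
    (hz : z ∈ Icc c d) (hzE : z ∉ Elam f lam) :
    (∫⁻ y in Ioo c d, ENNReal.ofReal |f y|) / volume (Ioo c d) ≤ ENNReal.ofReal lam := by
  rcases (hz.1.trans hz.2).eq_or_lt with rfl | hcd
  · simp
  · exact not_lt.1 fun h => hzE (Icc_subset_Elam hlam hcd h hz)

lemma M1_mono {f g : ℝ → ℝ} (h : ∀ x, |f x| ≤ |g x|) (x : ℝ) : M1 f x ≤ M1 g x := by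
  refine iSup₂_mono fun a b => iSup₂_mono fun _ _ => ?_
  exact ENNReal.div_le_div_right (lintegral_mono fun y => ofReal_le_ofReal (h y)) _

lemma setLIntegral_div_le_M1 (f : ℝ → ℝ) {a b x : ℝ} (hx : x ∈ Ioo a b) :
    (∫⁻ y in Ioo a b, ENNReal.ofReal |f y|) / volume (Ioo a b) ≤ M1 f x :=
  le_iSup₂_of_le a b (le_iSup₂_of_le (hx.1.trans hx.2) hx le_rfl)

lemma setLIntegral_div_le_M1_indicator (f : ℝ → ℝ) {s : Set ℝ} {c d x : ℝ}
    (hx : x ∈ Ioo c d) (hs : Ioo c d ⊆ s) :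
    (∫⁻ y in Ioo c d, ENNReal.ofReal |f y|) / volume (Ioo c d) ≤ M1 (s.indicator f) x := by
  rw [setLIntegral_congr_fun (g := fun y => ENNReal.ofReal |s.indicator f y|) measurableSet_Ioo
    (fun y hy => by simp only [indicator_of_mem (hs hy)])]
  exact setLIntegral_div_le_M1 _ hx

lemma setLIntegral_div_le_of_inter_compl_nonempty {f : ℝ → ℝ} {lam c d x : ℝ}
    (h : (Ioo c d ∩ connectedComponentIn (Elam f lam) x).Nonempty)
    (h' : (Ioo c d ∩ (connectedComponentIn (Elam f lam) x)ᶜ).Nonempty) :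
    (∫⁻ y in Ioo c d, ENNReal.ofReal |f y|) / volume (Ioo c d) ≤ ENNReal.ofReal lam := by
  obtain ⟨z, hz, hzc⟩ := h'
  exact not_lt.1 fun hlt => hzc (subset_connectedComponentIn_of_inter_nonempty
    isPreconnected_Ioo (Ioo_subset_Elam hlt) h hz)

lemma M1_eq_M1_indicator_connectedComponentIn (f : ℝ → ℝ) {lam x y : ℝ}
    (hy : y ∈ connectedComponentIn (Elam f lam) x) :
    M1 f y = M1 ((connectedComponentIn (Elam f lam) x).indicator f) y := by
  set s := connectedComponentIn (Elam f lam) x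
  refine le_antisymm ?_ (M1_mono (fun z => ?_) y)
  · have hlam : ENNReal.ofReal lam ≤ M1 (s.indicator f) y := by
      obtain ⟨c, d, hycd, h⟩ := mem_Elam_iff.1 (connectedComponentIn_subset _ _ hy)
      exact h.le.trans (setLIntegral_div_le_M1_indicator f hycd
        (subset_connectedComponentIn_of_inter_nonempty isPreconnected_Ioo (Ioo_subset_Elam h)
          ⟨y, hycd, hy⟩))
    refine iSup₂_le fun c d => iSup₂_le fun _ hycd => ?_
    by_cases hsub : Ioo c d ⊆ s
    · exact setLIntegral_div_le_M1_indicator f hycd hsub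
    · obtain ⟨z, hz, hzs⟩ := not_subset.1 hsub
      exact (setLIntegral_div_le_of_inter_compl_nonempty ⟨y, hycd, hy⟩ ⟨z, hz, hzs⟩).trans hlam
  · by_cases hz : z ∈ s <;> simp [hz]

/-- Two-sided rising sun lemma: structure of the connected components of
`E_λ = {Mf > λ}` for an integrable compactly supported `f ≥ 0`:
every component is a bounded open interval; (i) any interval with average `> λ`
is contained in a single component, and consequently any interval meeting a
component and its complement has average `≤ λ`; (ii) on a component `(a,b)`,
`⨍_{(a,x)} f ≤ λ` and `⨍_{(x,b)} f ≤ λ` for all `x ∈ [a,b]`; (iii) the maximal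
function localizes: `Mf = M(f·1_{(a,b)})` on `(a,b)`. -/
theorem stmt7 (f : ℝ → ℝ) (hf0 : ∀ x, 0 ≤ f x) (hfi : Integrable f)
    (hfc : HasCompactSupport f) (lam : ℝ) (hlam : 0 < lam) :
    (∀ x ∈ Elam f lam, ∃ a b : ℝ, a < b ∧
        connectedComponentIn (Elam f lam) x = Set.Ioo a b) ∧
      (∀ c d : ℝ, c < d →
        ENNReal.ofReal lam <
          (∫⁻ y in Set.Ioo c d, ENNReal.ofReal (f y)) / volume (Set.Ioo c d) →
        ∃ x ∈ Elam f lam, Set.Ioo c d ⊆ connectedComponentIn (Elam f lam) x) ∧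
      (∀ x ∈ Elam f lam, ∀ c d : ℝ, c < d →
        (Set.Ioo c d ∩ connectedComponentIn (Elam f lam) x).Nonempty →
        (Set.Ioo c d ∩ (connectedComponentIn (Elam f lam) x)ᶜ).Nonempty →
        (∫⁻ y in Set.Ioo c d, ENNReal.ofReal (f y)) / volume (Set.Ioo c d) ≤
          ENNReal.ofReal lam) ∧
      (∀ x ∈ Elam f lam, ∀ a b : ℝ, a < b →
        connectedComponentIn (Elam f lam) x = Set.Ioo a b →
        ∀ y ∈ Set.Icc a b,
          (∫⁻ t in Set.Ioo a y, ENNReal.ofReal (f t)) / ENNReal.ofReal (y - a) ≤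
              ENNReal.ofReal lam ∧
            (∫⁻ t in Set.Ioo y b, ENNReal.ofReal (f t)) / ENNReal.ofReal (b - y) ≤
              ENNReal.ofReal lam) ∧
      (∀ x ∈ Elam f lam, ∀ a b : ℝ, a < b →
        connectedComponentIn (Elam f lam) x = Set.Ioo a b →
        ∀ y ∈ Set.Ioo a b, M1 f y = M1 ((Set.Ioo a b).indicator f) y) := by
  have habs : ∀ c d : ℝ, ∫⁻ y in Ioo c d, ENNReal.ofReal (f y) =
      ∫⁻ y in Ioo c d, ENNReal.ofReal |f y| := fun c d => by
    simp only [abs_of_nonneg (hf0 _)]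
  simp only [habs]
  refine ⟨fun x hx => ?_, fun c d hcd h => ?_, fun x _ c d _ h h' =>
    setLIntegral_div_le_of_inter_compl_nonempty h h', fun x _ a b hab heq y hy => ?_,
    fun x _ a b _ heq y hy => ?_⟩
  · exact isPreconnected_connectedComponentIn.exists_eq_Ioo (isOpen_Elam f lam).connectedComponentIn
      ((isBounded_Elam hfi hfc hlam).subset (connectedComponentIn_subset _ _))
      ⟨x, mem_connectedComponentIn hx⟩
  · obtain ⟨x, hx⟩ := nonempty_Ioo.2 hcd
    exact ⟨x, Ioo_subset_Elam h hx,
      isPreconnected_Ioo.subset_connectedComponentIn hx (Ioo_subset_Elam h)⟩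
  · have hdisj := disjoint_frontier_connectedComponentIn (isOpen_Elam f lam) x
    rw [heq, frontier_Ioo hab] at hdisj
    have ha : a ∉ Elam f lam := fun h => disjoint_left.1 hdisj h (by simp)
    have hb : b ∉ Elam f lam := fun h => disjoint_left.1 hdisj h (by simp)
    simp only [← Real.volume_Ioo]
    exact ⟨setLIntegral_div_le_of_notMem_Elam hlam (left_mem_Icc.2 hy.1) ha,
      setLIntegral_div_le_of_notMem_Elam hlam (right_mem_Icc.2 hy.2) hb⟩
  · rw [← heq] at hy ⊢
    exact M1_eq_M1_indicator_connectedComponentIn f hy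
end
end
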